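/- Let g = e^{2u} g_euc be a smooth conformal metric on the unit disk D with μ(B_r^g(z), g)/(π r²) < Λ₁ for every r > 0 and z ∈ D_{3/4}, and ∫_D |K(g)| dμ_g ≤ ε₀ (ε₀ the constant of the main estimate). Let c be the mean value of u along the circle ∂D_{1/4}. Then for every q < 4π/ε₀, ∫_{D_{1/2}} e^{q(u−c)} < C(q, ε₀, Λ₁). -/

import Mathlib

open MeasureTheory Filter Metric
open scoped Topology ENNReal

noncomputable section

/-- The Laplacian of `u : ℂ → ℝ` (sum of the two pure second derivatives). -/
def lap (u : ℂ → ℝ) (x : ℂ) : ℝ :=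
  iteratedFDeriv ℝ 2 u x ![1, 1] + iteratedFDeriv ℝ 2 u x ![Complex.I, Complex.I]

/-- Gauss curvature of the conformal metric `e^{2u} g_euc`: `K = -e^{-2u} Δu`. -/
def gauss (u : ℂ → ℝ) (x : ℂ) : ℝ := -Real.exp (-(2 * u x)) * lap u x

/-- Area `μ(A, g)` of a set for the metric `g = e^{2u} g_euc`. -/
def confAreaE (u : ℂ → ℝ) (A : Set ℂ) : ℝ≥0∞ :=
  ∫⁻ x in A, ENNReal.ofReal (Real.exp (2 * u x))

/-- Total curvature `∫_A |K(g)| dμ_g` of the metric `g = e^{2u} g_euc`. -/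
def curvIntE (u : ℂ → ℝ) (A : Set ℂ) : ℝ≥0∞ :=
  ∫⁻ x in A, ENNReal.ofReal (|gauss u x| * Real.exp (2 * u x))

/-- `C¹` paths from `x` to `y` staying in `S`. -/
def PathsIn (S : Set ℂ) (x y : ℂ) : Set (ℝ → ℂ) :=
  {γ | γ 0 = x ∧ γ 1 = y ∧ (∀ t ∈ Set.Icc (0:ℝ) 1, γ t ∈ S) ∧ ContDiff ℝ 1 γ}

/-- Length of a path for the metric `e^{2u} g_euc`. -/
def confLen (u : ℂ → ℝ) (γ : ℝ → ℂ) : ℝ :=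
  ∫ t in (0:ℝ)..1, Real.exp (u (γ t)) * ‖deriv γ t‖

/-- Geodesic distance (within `S`) of the conformal metric `e^{2u} g_euc`. -/
def confDist (u : ℂ → ℝ) (S : Set ℂ) (x y : ℂ) : ℝ :=
  sInf (confLen u '' PathsIn S x y)

/-- Metric ball `B_r^g(z)` of the conformal metric (within `S`). -/
def confBall (u : ℂ → ℝ) (S : Set ℂ) (z : ℂ) (r : ℝ) : Set ℂ :=
  {x ∈ S | confDist u S z x < r}

/-- `‖f‖_{L^{2,∞}(Ω)} ≤ C`, i.e. `t·|{|f| > t}|^{1/2} ≤ C` for all `t > 0`. -/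
def wL2Bound (f : ℂ → ℝ) (Ω : Set ℂ) (C : ℝ) : Prop :=
  ∀ t : ℝ, 0 < t → t * (volume {x ∈ Ω | t < |f x|}).toReal ^ ((1:ℝ)/2) ≤ C

/-- The `W^{1,p}(Ω)` norm of a differentiable function (via its classical gradient). -/
def w1pNormE (u : ℂ → ℝ) (Ω : Set ℂ) (p : ℝ) : ℝ≥0∞ :=
  (∫⁻ x in Ω, ENNReal.ofReal (|u x| ^ p)) ^ (1/p)
    + (∫⁻ x in Ω, ENNReal.ofReal (‖fderiv ℝ u x‖ ^ p)) ^ (1/p)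

/-- Real dot product on `ℂ = ℝ²`. -/
def dotC (a b : ℂ) : ℝ := a.re * b.re + a.im * b.im

/-- `V` is the distributional (weak) gradient of `u` on `Ω`. -/
def IsWeakGradOn (Ω : Set ℂ) (u : ℂ → ℝ) (V : ℂ → ℂ) : Prop :=
  ∀ φ : ℂ → ℝ, ContDiff ℝ (⊤ : ℕ∞) φ → HasCompactSupport φ → tsupport φ ⊆ Ω →
    ∀ w : ℂ, ∫ x in Ω, u x * fderiv ℝ φ x w = -∫ x in Ω, dotC (V x) w * φ x

/-- `v k → u` weakly in `W^{1,p}(Ω)`: uniformly bounded `W^{1,p}` norms together with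
convergence, tested against smooth compactly supported functions, of the functions and of
their weak gradients. -/
def WeakW1pLim (Ω : Set ℂ) (p : ℝ) (v : ℕ → ℂ → ℝ) (u : ℂ → ℝ) : Prop :=
  ∃ V : ℕ → ℂ → ℂ,
    (∀ k, IsWeakGradOn Ω (v k) (V k)) ∧
    (∃ C : ℝ, ∀ k, (∫ x in Ω, |v k x| ^ p) ^ (1/p)
        + (∫ x in Ω, ‖V k x‖ ^ p) ^ (1/p) ≤ C) ∧
    (∀ φ : ℂ → ℝ, ContDiff ℝ (⊤ : ℕ∞) φ → HasCompactSupport φ → tsupport φ ⊆ Ω →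
      Tendsto (fun k => ∫ x in Ω, v k x * φ x) atTop (𝓝 (∫ x in Ω, u x * φ x)) ∧
      ∀ w : ℂ, Tendsto (fun k => ∫ x in Ω, dotC (V k x) w * φ x) atTop
        (𝓝 (-∫ x in Ω, u x * fderiv ℝ φ x w)))

/-- Mean value of `φ` on a set. -/
def avgOn (φ : ℂ → ℝ) (A : Set ℂ) : ℝ := (volume A).toReal⁻¹ * ∫ x in A, φ x

/-- Mean oscillation of `φ` on the disk `D_t(x₀)`. -/
def meanOsc (φ : ℂ → ℝ) (x₀ : ℂ) (t : ℝ) : ℝ :=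
  avgOn (fun x => |φ x - avgOn φ (ball x₀ t)|) (ball x₀ t)

/-- The John–Nirenberg radius `ρ(φ, x₀, Ω, λ)`. -/
def jnRad (φ : ℂ → ℝ) (x₀ : ℂ) (Ω : Set ℂ) (lam : ℝ) : ℝ :=
  sSup {r : ℝ | 0 ≤ r ∧ ∀ t : ℝ, 0 < t → t < r → ball x₀ t ⊆ Ω ∧ meanOsc φ x₀ t ≤ lam}

/-- Mean value of `u` along the circle `∂D_r(0)`. -/
def circMean (u : ℂ → ℝ) (r : ℝ) : ℝ :=
  (2 * Real.pi)⁻¹ * ∫ θ in (0:ℝ)..(2 * Real.pi), u ((r : ℂ) * Complex.exp ((θ : ℂ) * Complex.I))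

/-- Completeness of the conformal metric `e^{2v} g_euc` on all of `ℂ`. -/
def ConfComplete (v : ℂ → ℝ) : Prop :=
  ∀ x : ℕ → ℂ,
    (∀ ε : ℝ, 0 < ε → ∃ N : ℕ, ∀ m ≥ N, ∀ n ≥ N, confDist v Set.univ (x m) (x n) < ε) →
    ∃ l : ℂ, Tendsto (fun n => confDist v Set.univ (x n) l) atTop (𝓝 0)

/-- `(D, g_k)` extends to a complete conformal surface with total curvature at most `Λ`. -/
def ExtendsComplete (u : ℂ → ℝ) (Λ : ℝ) : Prop :=
  ∃ v : ℂ → ℝ, ContDiff ℝ (⊤ : ℕ∞) v ∧ Set.EqOn v u (ball (0:ℂ) 1) ∧ ConfComplete v ∧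
    curvIntE v Set.univ ≤ ENNReal.ofReal Λ

/-- Gromov–Hausdorff convergence of `(S, dk k)` to `(S, d)`, phrased through
correspondences of small distortion. -/
def GHTendsto (S : Set ℂ) (dk : ℕ → ℂ → ℂ → ℝ) (d : ℂ → ℂ → ℝ) : Prop :=
  ∀ ε : ℝ, 0 < ε → ∀ᶠ k in atTop, ∃ R : Set (ℂ × ℂ),
    (∀ p ∈ R, p.1 ∈ S ∧ p.2 ∈ S) ∧
    (∀ x ∈ S, ∃ y ∈ S, (x, y) ∈ R) ∧
    (∀ y ∈ S, ∃ x ∈ S, (x, y) ∈ R) ∧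
    (∀ p ∈ R, ∀ q ∈ R, |dk k p.1 q.1 - d p.2 q.2| < ε)

/-- `−Δu = f` on `Ω` in the sense of distributions. -/
def DistribLaplaceEq (Ω : Set ℂ) (u f : ℂ → ℝ) : Prop :=
  ∀ φ : ℂ → ℝ, ContDiff ℝ (⊤ : ℕ∞) φ → HasCompactSupport φ → tsupport φ ⊆ Ω →
    -∫ x in Ω, u x * lap φ x = ∫ x in Ω, f x * φ x



lemma ker_int {β : ℝ} (hβ : β < 2) (r : ℝ) :
    IntegrableOn (fun w : ℂ => ‖w‖ ^ (-β)) (ball 0 r) := by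
  refine integrableOn_ball_of_norm_le_rpow (C := 1) (α := β) (by simp) (by simpa using hβ) ?_ ?_
  · refine Eventually.of_forall fun x => ?_
    rw [Real.norm_of_nonneg (by positivity), one_mul]
  · exact (by fun_prop : Measurable fun w : ℂ => ‖w‖ ^ (-β)).aestronglyMeasurable

lemma abs_log_le {t : ℝ} (ht : 0 ≤ t) : |Real.log t| ≤ t⁻¹ + t := by
  rcases ht.eq_or_lt with rfl | ht
  · simp
  · rw [abs_le]
    have h1 := Real.log_le_sub_one_of_pos ht
    have h2 := Real.log_le_sub_one_of_pos (inv_pos.2 ht)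
    rw [Real.log_inv] at h2
    have := inv_pos.2 ht
    constructor <;> linarith

lemma log_int (r : ℝ) : IntegrableOn (fun w : ℂ => Real.log ‖w‖) (ball 0 r) := by
  refine integrableOn_ball_of_norm_le_rpow (C := 1 + r ^ 2) (α := 1) (by simp) (by simp) ?_ ?_
  · refine (ae_restrict_iff' measurableSet_ball).2 (Eventually.of_forall fun x hx => ?_)
    rw [mem_ball_zero_iff] at hx
    rw [Real.norm_eq_abs, Real.rpow_neg_one]
    refine (abs_log_le (norm_nonneg x)).trans ?_
    rcases (norm_nonneg x).eq_or_lt with h | h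
    · rw [← h]; simp
    · rw [add_mul, one_mul]
      gcongr
      rw [← div_eq_mul_inv, le_div_iff₀ h]
      nlinarith
  · exact (by fun_prop : Measurable fun w : ℂ => Real.log ‖w‖).aestronglyMeasurable

lemma log_locInt : LocallyIntegrable (fun w : ℂ => Real.log ‖w‖) := by
  rw [locallyIntegrable_iff]
  intro K hK
  obtain ⟨R, _, hR⟩ := hK.isBounded.exists_pos_norm_lt
  exact (log_int R).mono_set (fun x hx => mem_ball_zero_iff.mpr (hR x hx))

lemma logeps_deriv {ε : ℝ} (hε : 0 < ε) (y : ℂ) :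
    HasFDerivAt (fun y : ℂ => (1/2) * Real.log (‖y‖ ^ 2 + ε))
      ((‖y‖ ^ 2 + ε)⁻¹ • innerSL ℝ y) y := by
  have h1 : HasFDerivAt (fun y : ℂ => ‖y‖ ^ 2 + ε) (2 • innerSL ℝ y) y :=
    (hasStrictFDerivAt_norm_sq y).hasFDerivAt.add_const ε
  have h2 := (h1.log (by positivity)).const_mul (1/2)
  refine h2.congr_fderiv ?_
  ext e
  simp
  ring

lemma fund1 {φ : ℂ → ℝ} (hφ : ContDiff ℝ (⊤ : ℕ∞) φ) (hc : HasCompactSupport φ)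
    {ε : ℝ} (hε : 0 < ε) :
    ∫ y, (1/2) * Real.log (‖y‖ ^ 2 + ε) * lap φ y
      = - ∫ y, (‖y‖ ^ 2 + ε)⁻¹ * fderiv ℝ φ y y := by
  set f : ℂ → ℝ := fun y : ℂ => (1/2) * Real.log (‖y‖ ^ 2 + ε) with hf
  have hfd : ∀ y, fderiv ℝ f y = (‖y‖ ^ 2 + ε)⁻¹ • innerSL ℝ y := fun y => (logeps_deriv hε y).fderiv
  have hfc : Continuous f := by
    refine continuous_const.mul (Continuous.log (by fun_prop) fun y => by positivity)
  have hφ' : ContDiff ℝ (⊤ : ℕ∞) (fderiv ℝ φ) := hφ.fderiv_right (by simp)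
  have hφe : ∀ e : ℂ, ContDiff ℝ (⊤ : ℕ∞) (fun y => fderiv ℝ φ y e) := fun e =>
    hφ'.clm_apply contDiff_const
  have hce : ∀ e : ℂ, HasCompactSupport (fun y => fderiv ℝ φ y e) := fun e =>
    hc.fderiv_apply ℝ e
  have hφee : ∀ e : ℂ, Continuous (fun y => fderiv ℝ (fun y => fderiv ℝ φ y e) y e) := fun e =>
    (((hφe e).fderiv_right (m := (⊤ : ℕ∞)) (by simp)).clm_apply contDiff_const).continuous
  have hcee : ∀ e : ℂ, HasCompactSupport (fun y => fderiv ℝ (fun y => fderiv ℝ φ y e) y e) :=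
    fun e => (hce e).fderiv_apply ℝ e
  have hi1 : ∀ e : ℂ, Integrable (fun y => f y * fderiv ℝ (fun y => fderiv ℝ φ y e) y e) :=
    fun e => (hfc.mul (hφee e)).integrable_of_hasCompactSupport (hcee e).mul_left
  have hi2 : ∀ e : ℂ, Integrable (fun y => fderiv ℝ f y e * fderiv ℝ φ y e) := by
    intro e
    refine Continuous.integrable_of_hasCompactSupport ?_ (hce e).mul_left
    refine Continuous.mul ?_ (hφe e).continuous
    simp only [hfd]
    have : Continuous fun y : ℂ => (‖y‖ ^ 2 + ε)⁻¹ :=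
      Continuous.inv₀ (by fun_prop) fun y => by positivity
    simp only [FunLike.coe_smul, Pi.smul_apply, innerSL_apply_apply, smul_eq_mul]
    fun_prop
  have key : ∀ e : ℂ, ∫ y, f y * fderiv ℝ (fun y => fderiv ℝ φ y e) y e
      = - ∫ y, fderiv ℝ f y e * fderiv ℝ φ y e := by
    intro e
    refine integral_mul_fderiv_eq_neg_fderiv_mul_of_integrable (hi2 e) (hi1 e) ?_ ?_ ?_
    · exact (hfc.mul (hφe e).continuous).integrable_of_hasCompactSupport (hce e).mul_left
    · exact fun x _ => (logeps_deriv hε x).differentiableAt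
    · exact fun x _ => (hφe e).differentiable (by simp) x
  have hlap : ∀ y, lap φ y = fderiv ℝ (fun y => fderiv ℝ φ y 1) y 1
      + fderiv ℝ (fun y => fderiv ℝ φ y Complex.I) y Complex.I := by
    intro y
    have h : ∀ e : ℂ, fderiv ℝ (fun y => fderiv ℝ φ y e) y e = fderiv ℝ (fderiv ℝ φ) y e e := by
      intro e
      rw [fderiv_clm_apply (hφ'.differentiable (by simp) y) (by fun_prop)]
      simp
    simp [lap, iteratedFDeriv_two_apply, h]
  simp_rw [hlap, mul_add]
  rw [integral_add (hi1 _) (hi1 _), key, key, ← neg_add, ← integral_add (hi2 _) (hi2 _)]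
  congr 2
  ext y
  have : fderiv ℝ φ y y = y.re * fderiv ℝ φ y 1 + y.im * fderiv ℝ φ y Complex.I := by
    have h0 : y = y.re • (1 : ℂ) + y.im • Complex.I := by
      simp
    calc fderiv ℝ φ y y = fderiv ℝ φ y (y.re • (1 : ℂ) + y.im • Complex.I) :=
          congrArg (fderiv ℝ φ y) h0
      _ = _ := by rw [map_add, map_smul, map_smul]; simp
  rw [this, hfd]
  simp [Complex.inner]
  ring


lemma lap_cont {φ : ℂ → ℝ} (hφ : ContDiff ℝ (⊤ : ℕ∞) φ) : Continuous (lap φ) := by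
  have h : Continuous (iteratedFDeriv ℝ 2 φ) := hφ.continuous_iteratedFDeriv (m := 2) (by exact ENat.LEInfty.out)
  unfold lap
  fun_prop

lemma lap_supp {φ : ℂ → ℝ} (hc : HasCompactSupport φ) : HasCompactSupport (lap φ) := by
  have h := hc.iteratedFDeriv (𝕜 := ℝ) 2
  refine h.mono fun x hx => ?_
  rw [Function.mem_support] at hx ⊢
  intro h0
  apply hx
  simp [lap, h0]

lemma int_bdd_mul {k f : ℂ → ℝ} (hk : ∀ r, IntegrableOn k (ball 0 r))
    (hf : Continuous f) (hc : HasCompactSupport f) : Integrable (fun y => k y * f y) := by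
  obtain ⟨R, hR⟩ := hc.isCompact.isBounded.subset_ball 0
  obtain ⟨M, hM⟩ := hf.bounded_above_of_compact_support hc
  have h1 : IntegrableOn (fun y => k y * f y) (ball 0 R) :=
    Integrable.mul_bdd (c := M) (hk R) hf.aestronglyMeasurable (Eventually.of_forall hM)
  refine (integrableOn_iff_integrable_of_support_subset ?_).1 h1
  intro y hy
  apply hR
  apply subset_tsupport
  rw [Function.mem_support] at hy ⊢
  exact right_ne_zero_of_mul hy

lemma fund2 {φ : ℂ → ℝ} (hφ : ContDiff ℝ (⊤ : ℕ∞) φ) (hc : HasCompactSupport φ) :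
    ∫ y, Real.log ‖y‖ * lap φ y = - ∫ y, (‖y‖ ^ 2)⁻¹ * fderiv ℝ φ y y := by
  have hφ' : Continuous (fderiv ℝ φ) := (hφ.fderiv_right (m := (⊤ : ℕ∞)) (by simp)).continuous
  have hφ'' : Continuous (fun y => ‖fderiv ℝ φ y‖) := hφ'.norm
  have hφ3 : Continuous (fun y => fderiv ℝ φ y y) := by fun_prop
  have hcn : HasCompactSupport (fun y => ‖fderiv ℝ φ y‖) := (hc.fderiv (𝕜 := ℝ)).norm
  let e : ℕ → ℝ := fun n => 1 / ((n : ℝ) + 1)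
  have he : ∀ n, 0 < e n := fun n => by positivity
  have he1 : ∀ n, e n ≤ 1 := fun n => by
    simp only [e]; rw [div_le_one (by positivity)]; linarith [(Nat.cast_nonneg n : (0:ℝ) ≤ n)]
  have hel : Tendsto e atTop (𝓝 0) := tendsto_one_div_add_atTop_nhds_zero_nat
  have hne : ∀ᵐ y : ℂ, y ≠ 0 := by
    simp [ae_iff]
  have L1 : Tendsto (fun n => ∫ y, (1/2) * Real.log (‖y‖ ^ 2 + e n) * lap φ y) atTop
      (𝓝 (∫ y, Real.log ‖y‖ * lap φ y)) := by
    refine tendsto_integral_filter_of_dominated_convergence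
      (fun y => |Real.log ‖y‖| * |lap φ y| + (‖y‖ ^ 2) * |lap φ y|) ?_ ?_ ?_ ?_
    · refine Eventually.of_forall fun n => ?_
      have : Measurable fun y : ℂ => (1/2) * Real.log (‖y‖ ^ 2 + e n) := by fun_prop
      exact (this.mul (lap_cont hφ).measurable).aestronglyMeasurable
    · refine Eventually.of_forall fun n => ?_
      filter_upwards [hne] with y hy
      rw [norm_mul, ← add_mul, Real.norm_eq_abs, Real.norm_eq_abs]
      gcongr
      have hy' : 0 < ‖y‖ := norm_pos_iff.2 hy
      have h1 : 2 * Real.log ‖y‖ = Real.log (‖y‖ ^ 2) := by rw [Real.log_pow]; norm_num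
      have h2 : Real.log (‖y‖ ^ 2) ≤ Real.log (‖y‖ ^ 2 + e n) :=
        Real.log_le_log (by positivity) (by linarith [he n])
      have h3 : Real.log (‖y‖ ^ 2 + e n) ≤ ‖y‖ ^ 2 + e n - 1 :=
        Real.log_le_sub_one_of_pos (by positivity)
      have h4 := neg_abs_le (Real.log ‖y‖)
      have h5 := abs_nonneg (Real.log ‖y‖)
      have h6 : 0 ≤ ‖y‖ ^ 2 := by positivity
      have := he1 n
      rw [abs_le]
      constructor <;> nlinarith
    · refine Integrable.add ?_ ?_
      · exact int_bdd_mul (fun r => (log_int r).abs) (lap_cont hφ).abs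
          ((lap_supp hc).abs)
      · refine Continuous.integrable_of_hasCompactSupport ?_ ((lap_supp hc).abs).mul_left
        have := lap_cont hφ
        fun_prop
    · filter_upwards [hne] with y hy
      refine Tendsto.mul_const _ ?_
      have hy' : 0 < ‖y‖ := norm_pos_iff.2 hy
      have h1 : Real.log ‖y‖ = 1/2 * Real.log (‖y‖ ^ 2 + 0) := by
        rw [add_zero, Real.log_pow]; push_cast; ring
      rw [h1]
      refine Tendsto.const_mul _ (Tendsto.log ?_ (by positivity))
      exact hel.const_add _
  have L2 : Tendsto (fun n => - ∫ y, (‖y‖ ^ 2 + e n)⁻¹ * fderiv ℝ φ y y) atTop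
      (𝓝 (- ∫ y, (‖y‖ ^ 2)⁻¹ * fderiv ℝ φ y y)) := by
    refine Tendsto.neg ?_
    refine tendsto_integral_filter_of_dominated_convergence
      (fun y => ‖y‖ ^ (-1 : ℝ) * ‖fderiv ℝ φ y‖) ?_ ?_ ?_ ?_
    · refine Eventually.of_forall fun n => ?_
      have : Measurable fun y : ℂ => (‖y‖ ^ 2 + e n)⁻¹ := by fun_prop
      exact (this.mul hφ3.measurable).aestronglyMeasurable
    · refine Eventually.of_forall fun n => ?_
      filter_upwards [hne] with y hy
      have hy' : 0 < ‖y‖ := norm_pos_iff.2 hy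
      rw [norm_mul, Real.rpow_neg_one, Real.norm_of_nonneg (by have := he n; positivity)]
      calc (‖y‖ ^ 2 + e n)⁻¹ * ‖fderiv ℝ φ y y‖
          ≤ (‖y‖ ^ 2)⁻¹ * (‖fderiv ℝ φ y‖ * ‖y‖) := by
            gcongr
            · linarith [he n]
            · exact ContinuousLinearMap.le_opNorm _ _
        _ = _ := by field_simp
    · exact int_bdd_mul (ker_int (by norm_num)) hφ'' hcn
    · filter_upwards [hne] with y hy
      refine Tendsto.mul_const _ ?_
      have hy' : 0 < ‖y‖ := norm_pos_iff.2 hy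
      refine Tendsto.inv₀ ?_ (by positivity)
      simpa using hel.const_add (‖y‖ ^ 2)
  refine tendsto_nhds_unique L1 ?_
  simpa only [fund1 hφ hc (he _)] using L2

lemma fund3 {φ : ℂ → ℝ} (hφ : ContDiff ℝ (⊤ : ℕ∞) φ) (hc : HasCompactSupport φ) :
    ∫ y, Real.log ‖y‖ * lap φ y = 2 * Real.pi * φ 0 := by
  rw [fund2 hφ hc, ← Complex.integral_comp_polarCoord_symm]
  have hφ' : Continuous (fderiv ℝ φ) := (hφ.fderiv_right (m := (⊤ : ℕ∞)) (by simp)).continuous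
  obtain ⟨R, hR⟩ := hc.isCompact.isBounded.subset_ball 0
  set E : ℝ → ℂ := fun θ => Real.cos θ + Real.sin θ * Complex.I with hE
  have hEn : ∀ θ, ‖E θ‖ = 1 := by
    intro θ
    simp only [hE]
    push_cast
    rw [Complex.norm_cos_add_sin_mul_I]
  have hEc : Continuous E := by fun_prop
  have hz : ∀ r θ, R ≤ |r| → φ ((r : ℂ) * E θ) = 0 := by
    intro r θ hr
    by_contra h
    have := hR (subset_tsupport _ (Function.mem_support.2 h))
    rw [mem_ball_zero_iff, norm_mul, hEn, mul_one, Complex.norm_real, Real.norm_eq_abs] at this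
    linarith
  have hz' : ∀ r θ, R ≤ |r| → fderiv ℝ φ ((r : ℂ) * E θ) = 0 := by
    intro r θ hr
    by_contra h
    have := hR (support_fderiv_subset ℝ (Function.mem_support.2 h))
    rw [mem_ball_zero_iff, norm_mul, hEn, mul_one, Complex.norm_real, Real.norm_eq_abs] at this
    linarith
  set G : ℝ × ℝ → ℝ := fun p => fderiv ℝ φ ((p.1 : ℂ) * E p.2) (E p.2) with hG
  have hGc : Continuous G := by
    have : Continuous fun p : ℝ × ℝ => fderiv ℝ φ ((p.1 : ℂ) * E p.2) := by fun_prop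
    exact this.clm_apply (by fun_prop)
  have h1 : ∫ p in polarCoord.target, p.1 • ((‖Complex.polarCoord.symm p‖ ^ 2)⁻¹ *
      fderiv ℝ φ (Complex.polarCoord.symm p) (Complex.polarCoord.symm p))
      = ∫ p in Set.Ioi (0:ℝ) ×ˢ Set.Ioo (-Real.pi) Real.pi, G p := by
    refine setIntegral_congr_fun (measurableSet_Ioi.prod measurableSet_Ioo) ?_
    rintro ⟨r, θ⟩ ⟨hr, -⟩
    have hr : 0 < r := hr
    simp only [Complex.polarCoord_symm_apply, hG]
    rw [show ((Real.cos θ : ℂ) + Real.sin θ * Complex.I) = E θ from rfl, norm_mul, hEn]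
    rw [show (r : ℂ) * E θ = r • E θ by simp, map_smul]
    simp
    field_simp
  rw [h1]
  have hint : IntegrableOn G (Set.Ioi (0:ℝ) ×ˢ Set.Ioo (-Real.pi) Real.pi) := by
    have hk : IntegrableOn G (Set.Icc 0 |R| ×ˢ Set.Icc (-Real.pi) Real.pi) :=
      hGc.continuousOn.integrableOn_compact (isCompact_Icc.prod isCompact_Icc)
    have : IntegrableOn G (Set.Ioi (0:ℝ) ×ˢ Set.Icc (-Real.pi) Real.pi) := by
      refine IntegrableOn.of_forall_sdiff_eq_zero hk
        (measurableSet_Ioi.prod measurableSet_Icc) ?_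
      rintro ⟨r, θ⟩ ⟨⟨h1, h2⟩, h3⟩
      have h1 : 0 < r := h1
      have : |R| < r := by
        by_contra! h
        exact h3 ⟨⟨h1.le, h⟩, h2⟩
      simp [hG, hz' r θ (by rw [abs_of_pos h1]; exact (le_abs_self R).trans this.le)]
    exact this.mono_set (Set.prod_mono le_rfl Set.Ioo_subset_Icc_self)
  rw [Measure.volume_eq_prod] at hint ⊢
  have hint2 : IntegrableOn (fun q : ℝ × ℝ => G q.swap) (Set.Ioo (-Real.pi) Real.pi ×ˢ Set.Ioi (0:ℝ))
      (volume.prod volume) := hint.swap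
  rw [← setIntegral_prod_swap, setIntegral_prod _ hint2]
  have h2 : ∀ θ, ∫ r in Set.Ioi (0:ℝ), G (r, θ) = - φ 0 := by
    intro θ
    have hcd : ContDiff ℝ 1 (fun r : ℝ => φ ((r : ℂ) * E θ)) := by
      have : ContDiff ℝ 1 φ := hφ.of_le (by simp)
      refine this.comp ?_
      exact (Complex.ofRealCLM.contDiff).mul contDiff_const
    have hcs : HasCompactSupport (fun r : ℝ => φ ((r : ℂ) * E θ)) := by
      refine HasCompactSupport.intro (isCompact_Icc (a := -|R|) (b := |R|)) fun r hr => ?_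
      apply hz
      by_contra! h
      apply hr
      rw [Set.mem_Icc, ← abs_le]
      exact h.le.trans (le_abs_self _)
    have := HasCompactSupport.integral_Ioi_deriv_eq hcd hcs 0
    simp only [Complex.ofReal_zero, zero_mul] at this
    rw [← this]
    refine integral_congr_ae (Eventually.of_forall fun r => ?_)
    have hd : HasDerivAt (fun r : ℝ => (r : ℂ) * E θ) (E θ) r := by
      simpa using (Complex.ofRealCLM.hasDerivAt (x := r)).mul_const (E θ)
    have hd2 := ((hφ.differentiable (by simp) ((r : ℂ) * E θ)).hasFDerivAt).comp_hasDerivAt r hd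
    exact hd2.deriv.symm
  simp only [Prod.swap_prod_mk, h2]
  simp
  left
  rw [max_eq_left (by positivity)]
  ring


lemma two_le_inf : (2 : WithTop ℕ∞) ≤ ((⊤ : ℕ∞) : WithTop ℕ∞) := by
  exact ENat.LEInfty.out

lemma lap_eq {φ : ℂ → ℝ} (hφ : ContDiff ℝ (⊤ : ℕ∞) φ) (y : ℂ) :
    lap φ y = fderiv ℝ (fun y => fderiv ℝ φ y 1) y 1
      + fderiv ℝ (fun y => fderiv ℝ φ y Complex.I) y Complex.I := by
  have hφ' : ContDiff ℝ (⊤ : ℕ∞) (fderiv ℝ φ) := hφ.fderiv_right (by simp)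
  have h : ∀ e : ℂ, fderiv ℝ (fun y => fderiv ℝ φ y e) y e = fderiv ℝ (fderiv ℝ φ) y e e := by
    intro e
    rw [fderiv_clm_apply (hφ'.differentiable (by simp) y) (by fun_prop)]
    simp
  simp [lap, iteratedFDeriv_two_apply, h]

lemma fderiv_refl {φ : ℂ → ℝ} (hφ : Differentiable ℝ φ) (x y e : ℂ) :
    fderiv ℝ (fun y => φ (x - y)) y e = - fderiv ℝ φ (x - y) e := by
  have h1 : HasFDerivAt (fun y : ℂ => x - y) (-ContinuousLinearMap.id ℝ ℂ) y :=
    (hasFDerivAt_id y).const_sub x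
  have := (hφ (x - y)).hasFDerivAt.comp y h1
  rw [show (fun y => φ (x - y)) = φ ∘ (fun y => x - y) from rfl, this.fderiv]
  simp

lemma lap_refl {φ : ℂ → ℝ} (hφ : ContDiff ℝ (⊤ : ℕ∞) φ) (x y : ℂ) :
    lap (fun y => φ (x - y)) y = lap φ (x - y) := by
  have hφ' : ContDiff ℝ (⊤ : ℕ∞) (fderiv ℝ φ) := hφ.fderiv_right (by simp)
  have hφe : ∀ e : ℂ, ContDiff ℝ (⊤ : ℕ∞) (fun y => fderiv ℝ φ y e) := fun e =>
    hφ'.clm_apply contDiff_const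
  have hr : ContDiff ℝ (⊤ : ℕ∞) (fun y => φ (x - y)) := hφ.comp (contDiff_const.sub contDiff_id)
  rw [lap_eq hr, lap_eq hφ]
  have h : ∀ e : ℂ, fderiv ℝ (fun y => fderiv ℝ (fun y => φ (x - y)) y e) y e
      = fderiv ℝ (fun y => fderiv ℝ φ y e) (x - y) e := by
    intro e
    simp_rw [fderiv_refl (hφ.differentiable (by simp)) x _ e]
    have := fderiv_refl ((hφe e).differentiable (by simp)) x y e
    rw [fderiv_fun_neg]
    simp only [FunLike.coe_neg, Pi.neg_apply]
    rw [this]; simp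
  rw [h, h]

/-- Newtonian potential. -/
def lpot (g : ℂ → ℝ) (x : ℂ) : ℝ := -(2 * Real.pi)⁻¹ * ∫ y, Real.log ‖y‖ * g (x - y)

lemma lpot_eq (g : ℂ → ℝ) (x : ℂ) :
    lpot g x = -(2 * Real.pi)⁻¹ * ∫ y, Real.log ‖x - y‖ * g y := by
  unfold lpot
  congr 1
  rw [← integral_sub_left_eq_self (fun y => Real.log ‖x - y‖ * g y) volume x]
  simp

lemma lpot_conv (g : ℂ → ℝ) :
    lpot g = fun x => -(2 * Real.pi)⁻¹ *
      (convolution (fun y : ℂ => Real.log ‖y‖) g (ContinuousLinearMap.mul ℝ ℝ) volume) x := by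
  ext x
  simp [lpot, convolution]

lemma lpot_contDiff {g : ℂ → ℝ} (hg : ContDiff ℝ (⊤ : ℕ∞) g) (hc : HasCompactSupport g) :
    ContDiff ℝ (⊤ : ℕ∞) (lpot g) := by
  rw [lpot_conv]
  exact contDiff_const.mul (hc.contDiff_convolution_right _ log_locInt hg)

lemma lpot_fderiv {g : ℂ → ℝ} (hg : ContDiff ℝ (⊤ : ℕ∞) g) (hc : HasCompactSupport g) (x e : ℂ) :
    fderiv ℝ (lpot g) x e = lpot (fun y => fderiv ℝ g y e) x := by
  have h1 := hc.hasFDerivAt_convolution_right (ContinuousLinearMap.mul ℝ ℝ) log_locInt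
    (hg.of_le (by simp)) x
  rw [lpot_conv, lpot_conv, (h1.const_mul _).fderiv]
  have hg' : Continuous (fderiv ℝ g) := (hg.fderiv_right (m := (⊤ : ℕ∞)) (by simp)).continuous
  have h2 := convolution_precompR_apply (ContinuousLinearMap.mul ℝ ℝ) log_locInt
    (hc.fderiv ℝ) hg' x e
  simp only [FunLike.coe_smul, Pi.smul_apply, smul_eq_mul]
  rw [← h2]

lemma lap_lpot {g : ℂ → ℝ} (hg : ContDiff ℝ (⊤ : ℕ∞) g) (hc : HasCompactSupport g) (x : ℂ) :
    lap (lpot g) x = - g x := by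
  have hg' : ContDiff ℝ (⊤ : ℕ∞) (fderiv ℝ g) := hg.fderiv_right (by simp)
  have hge : ∀ e : ℂ, ContDiff ℝ (⊤ : ℕ∞) (fun y => fderiv ℝ g y e) := fun e =>
    hg'.clm_apply contDiff_const
  have hce : ∀ e : ℂ, HasCompactSupport (fun y => fderiv ℝ g y e) := fun e =>
    hc.fderiv_apply ℝ e
  have hgee : ∀ e : ℂ, Continuous (fun y => fderiv ℝ (fun y => fderiv ℝ g y e) y e) := fun e =>
    (((hge e).fderiv_right (m := (⊤ : ℕ∞)) (by simp)).clm_apply contDiff_const).continuous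
  have hcee : ∀ e : ℂ, HasCompactSupport (fun y => fderiv ℝ (fun y => fderiv ℝ g y e) y e) :=
    fun e => (hce e).fderiv_apply ℝ e
  have hi : ∀ e : ℂ, Integrable (fun y => Real.log ‖y‖ *
      fderiv ℝ (fun y => fderiv ℝ g y e) (x - y) e) := by
    intro e
    refine int_bdd_mul log_int ((hgee e).comp (by fun_prop)) ?_
    exact (hcee e).comp_homeomorph (Homeomorph.subLeft x)
  rw [lap_eq (lpot_contDiff hg hc)]
  simp_rw [lpot_fderiv hg hc]
  have e1 : ∀ e, (fderiv ℝ (fun y ↦ lpot (fun y ↦ fderiv ℝ g y e) y) x) e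
    = lpot (fun y => fderiv ℝ (fun y => fderiv ℝ g y e) y e) x := fun e => lpot_fderiv (hge e) (hce e) x e
  rw [e1, e1]
  unfold lpot
  rw [← mul_add, ← integral_add (hi _) (hi _)]
  simp_rw [← mul_add, ← lap_eq hg, ← lap_refl hg]
  have hr : ContDiff ℝ (⊤ : ℕ∞) (fun y => g (x - y)) := hg.comp (contDiff_const.sub contDiff_id)
  rw [fund3 hr (hc.comp_homeomorph (Homeomorph.subLeft x))]
  simp
  field_simp


lemma ofReal_int_le {f : ℂ → ℝ} (hf : Integrable f) :
    ENNReal.ofReal (∫ y, f y) ≤ ∫⁻ y, ENNReal.ofReal (f y) := by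
  have h : ∫ y, f y ≤ ∫ y, max (f y) 0 :=
    integral_mono hf hf.pos_part (fun y => le_max_left _ _)
  refine (ENNReal.ofReal_le_ofReal h).trans ?_
  rw [ofReal_integral_eq_lintegral_ofReal hf.pos_part (Eventually.of_forall fun y => le_max_right _ _)]
  refine lintegral_mono fun y => ?_
  rcases le_total (f y) 0 with h | h <;> simp [h]

lemma jensen {G ρ : ℂ → ℝ} (hρ : Integrable ρ) (hρ0 : ∀ y, 0 ≤ ρ y) (hρ1 : ∫ y, ρ y ≤ 1)
    (hG : ∀ y, 0 ≤ G y) :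
    ENNReal.ofReal (Real.exp (∫ y, G y * ρ y) - 1) ≤
      ∫⁻ y, ENNReal.ofReal ((Real.exp (G y) - 1) * ρ y) := by
  by_cases hi : Integrable (fun y => G y * ρ y)
  · set A := ∫ y, G y * ρ y with hA
    have hA0 : 0 ≤ A := integral_nonneg fun y => mul_nonneg (hG y) (hρ0 y)
    have h1 : Integrable (fun y => (Real.exp A - 1 - Real.exp A * A) * ρ y
        + Real.exp A * (G y * ρ y)) := (hρ.const_mul _).add (hi.const_mul _)
    have h2 : ∫ y, ((Real.exp A - 1 - Real.exp A * A) * ρ y + Real.exp A * (G y * ρ y))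
        = (Real.exp A - 1 - Real.exp A * A) * (∫ y, ρ y) + Real.exp A * A := by
      rw [integral_add (hρ.const_mul _) (hi.const_mul _), integral_const_mul, integral_const_mul]
    have h3 : Real.exp A - 1 ≤ ∫ y, ((Real.exp A - 1 - Real.exp A * A) * ρ y
        + Real.exp A * (G y * ρ y)) := by
      rw [h2]
      have h4 : Real.exp A - 1 - Real.exp A * A ≤ 0 := by
        have h5 := Real.add_one_le_exp (-A)
        have h6 : Real.exp A * Real.exp (-A) = 1 := by rw [← Real.exp_add]; simp
        nlinarith [Real.exp_pos A]
      nlinarith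
    refine (ENNReal.ofReal_le_ofReal h3).trans ((ofReal_int_le h1).trans ?_)
    refine lintegral_mono fun y => ENNReal.ofReal_le_ofReal ?_
    have h5 := Real.add_one_le_exp (G y - A)
    have h6 : Real.exp A * Real.exp (G y - A) = Real.exp (G y) := by rw [← Real.exp_add]; simp
    have h7 : Real.exp A - 1 - Real.exp A * A + Real.exp A * G y ≤ Real.exp (G y) - 1 := by
      nlinarith [Real.exp_pos A]
    nlinarith [mul_le_mul_of_nonneg_right h7 (hρ0 y)]
  · rw [integral_undef hi]; simp

lemma jt {F : ℂ → ℂ → ℝ} {ρ f : ℂ → ℝ} {S : Set ℂ} {B : ℝ≥0∞}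
    (hρ : Integrable ρ) (hρm : Measurable ρ) (hρ0 : ∀ y, 0 ≤ ρ y) (hρ1 : ∫ y, ρ y ≤ 1)
    (hF : ∀ x y, 0 ≤ F x y) (hFm : Measurable (Function.uncurry F)) (hS : MeasurableSet S)
    (hf : ∀ x ∈ S, |f x| ≤ ∫ y, F x y * ρ y)
    (hB : ∀ y, ρ y ≠ 0 → ∫⁻ x in S, ENNReal.ofReal (Real.exp (F x y) - 1) ≤ B) :
    ∫⁻ x in S, ENNReal.ofReal (Real.exp |f x| - 1) ≤ B * ENNReal.ofReal (∫ y, ρ y) := by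
  calc ∫⁻ x in S, ENNReal.ofReal (Real.exp |f x| - 1)
      ≤ ∫⁻ x in S, ∫⁻ y, ENNReal.ofReal ((Real.exp (F x y) - 1) * ρ y) := by
        refine setLIntegral_mono' hS fun x hx => ?_
        refine le_trans (ENNReal.ofReal_le_ofReal ?_) (jensen hρ hρ0 hρ1 (hF x))
        have := Real.exp_le_exp.2 (hf x hx)
        linarith
    _ = ∫⁻ y, ∫⁻ x in S, ENNReal.ofReal ((Real.exp (F x y) - 1) * ρ y) := by
        refine lintegral_lintegral_swap ?_
        refine Measurable.aemeasurable ?_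
        unfold Function.uncurry
        have : Measurable fun p : ℂ × ℂ => F p.1 p.2 := hFm
        fun_prop
    _ ≤ ∫⁻ y, B * ENNReal.ofReal (ρ y) := by
        refine lintegral_mono fun y => ?_
        have hm : Measurable fun x => F x y := hFm.comp (measurable_id.prodMk measurable_const)
        by_cases h : ρ y = 0
        · simp [h]
        · calc _ = ∫⁻ x in S, ENNReal.ofReal (Real.exp (F x y) - 1) * ENNReal.ofReal (ρ y) := by
                refine lintegral_congr fun x => ?_
                rw [ENNReal.ofReal_mul]
                have := Real.one_le_exp (hF x y)
                linarith
            _ = (∫⁻ x in S, ENNReal.ofReal (Real.exp (F x y) - 1)) * ENNReal.ofReal (ρ y) := by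
                rw [lintegral_mul_const]
                fun_prop
            _ ≤ _ := by gcongr; exact hB y h
    _ = B * ENNReal.ofReal (∫ y, ρ y) := by
        rw [lintegral_const_mul _ (by fun_prop),
          ofReal_integral_eq_lintegral_ofReal hρ (Eventually.of_forall hρ0)]


lemma trans_le {f : ℂ → ℝ≥0∞} {S T : Set ℂ} (hS : MeasurableSet S) (hT : MeasurableSet T) {y : ℂ}
    (h : ∀ x ∈ S, x - y ∈ T) : ∫⁻ x in S, f (x - y) ≤ ∫⁻ x in T, f x := by
  rw [← lintegral_indicator hS, ← lintegral_indicator hT,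
    ← lintegral_sub_right_eq_self (T.indicator f) y]
  refine lintegral_mono fun x => ?_
  by_cases hx : x ∈ S
  · simp [hx, h x hx]
  · simp [hx]

lemma ker_lint {β : ℝ} (hβ : β < 2) (r : ℝ) :
    ∫⁻ w in ball (0:ℂ) r, ENNReal.ofReal (‖w‖ ^ (-β)) < ⊤ :=
  (ker_int hβ r).lintegral_lt_top

lemma exp_abs_log {β t : ℝ} (hβ : 0 ≤ β) (ht : 0 ≤ t) (ht2 : t ≤ 2) :
    Real.exp (β * |Real.log t|) ≤ 2 ^ β + t ^ (-β) := by
  rcases ht.eq_or_lt with rfl | ht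
  · have : (1:ℝ) ≤ 2 ^ β := Real.one_le_rpow (by norm_num) hβ
    have h2 : 0 ≤ (0:ℝ) ^ (-β) := by positivity
    simp only [Real.log_zero, abs_zero, mul_zero, Real.exp_zero]
    linarith
  · rcases abs_cases (Real.log t) with ⟨h, _⟩ | ⟨h, _⟩
    · rw [h, mul_comm, ← Real.rpow_def_of_pos ht]
      have := Real.rpow_le_rpow ht.le ht2 hβ
      have h2 : 0 ≤ t ^ (-β) := by positivity
      linarith
    · rw [h, mul_neg, ← neg_mul, mul_comm, ← Real.rpow_def_of_pos ht]
      have h2 : 0 ≤ (2:ℝ) ^ β := by positivity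
      linarith

lemma bm {q ε₀ : ℝ} (hq : 0 < q) (hε : 0 < ε₀) (hqε : q * ε₀ < 4 * Real.pi) :
    ∃ C : ℝ, 0 ≤ C ∧ ∀ g : ℂ → ℝ, Continuous g → HasCompactSupport g →
      (∀ y, g y ≠ 0 → y ∈ ball (0:ℂ) 1) → ∫ y, |g y| ≤ ε₀ →
      ∫⁻ x in ball (0:ℂ) (1/2), ENNReal.ofReal (Real.exp (q * |lpot g x|)) ≤ ENNReal.ofReal C := by
  have hpi := Real.pi_pos
  set β := q * ε₀ / (2 * Real.pi) with hβ
  have hβ0 : 0 ≤ β := by positivity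
  have hβ2 : β < 2 := by rw [hβ, div_lt_iff₀ (by positivity)]; linarith
  set B : ℝ≥0∞ := ENNReal.ofReal (2 ^ β) * volume (ball (0:ℂ) (1/2)) +
    ∫⁻ w in ball (0:ℂ) 2, ENNReal.ofReal (‖w‖ ^ (-β)) with hB
  have hBt : B < ⊤ := ENNReal.add_lt_top.2
    ⟨ENNReal.mul_lt_top ENNReal.ofReal_lt_top measure_ball_lt_top, ker_lint hβ2 2⟩
  have hBt2 : B + volume (ball (0:ℂ) (1/2)) < ⊤ := ENNReal.add_lt_top.2 ⟨hBt, measure_ball_lt_top⟩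
  refine ⟨(B + volume (ball (0:ℂ) (1/2))).toReal, ENNReal.toReal_nonneg, ?_⟩
  intro g hg hc hs hm
  rw [ENNReal.ofReal_toReal hBt2.ne]
  have hgi : Integrable g := hg.integrable_of_hasCompactSupport hc
  have key := jt (F := fun x y => β * |Real.log ‖x - y‖|) (ρ := fun y => |g y| / ε₀)
    (f := fun x => q * |lpot g x|) (S := ball (0:ℂ) (1/2)) (B := B)
    (hgi.abs.div_const _) (by have := hg.measurable; fun_prop) (fun y => by positivity)
    (by rw [integral_div]; exact (div_le_one hε).2 hm)
    (fun x y => by positivity) (by unfold Function.uncurry; fun_prop) measurableSet_ball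
    (by
      intro x _
      have h1 : (fun y => β * |Real.log ‖x - y‖| * (|g y| / ε₀))
          = fun y => (q * (2 * Real.pi)⁻¹) * ‖Real.log ‖x - y‖ * g y‖ := by
        ext y; rw [norm_mul, Real.norm_eq_abs, Real.norm_eq_abs, hβ]; field_simp
      rw [h1, integral_const_mul, lpot_eq, abs_of_nonneg (by positivity), abs_mul, abs_neg,
        abs_of_nonneg (a := (2 * Real.pi)⁻¹) (by positivity), mul_assoc]
      gcongr
      exact norm_integral_le_integral_norm (fun y => Real.log ‖x - y‖ * g y))
    (by
      intro y hy
      have hy1 : y ∈ ball (0:ℂ) 1 := hs y (by intro h; apply hy; simp [h])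
      rw [mem_ball_zero_iff] at hy1
      calc _ ≤ ∫⁻ x in ball (0:ℂ) (1/2), (ENNReal.ofReal (2 ^ β) + ENNReal.ofReal (‖x - y‖ ^ (-β))) := by
            refine setLIntegral_mono' measurableSet_ball fun x hx => ?_
            rw [mem_ball_zero_iff] at hx
            rw [← ENNReal.ofReal_add (by positivity) (by positivity)]
            refine ENNReal.ofReal_le_ofReal ?_
            have := exp_abs_log hβ0 (norm_nonneg (x - y)) (by linarith [norm_sub_le x y])
            linarith
        _ ≤ B := by
            rw [lintegral_add_left (by fun_prop), lintegral_const, hB]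
            simp only [Measure.restrict_apply MeasurableSet.univ, Set.univ_inter]
            refine add_le_add le_rfl ?_
            refine trans_le (f := fun w => ENNReal.ofReal (‖w‖ ^ (-β))) measurableSet_ball measurableSet_ball ?_
            intro x hx
            rw [mem_ball_zero_iff] at hx ⊢
            linarith [norm_sub_le x y])
  calc _ ≤ ∫⁻ x in ball (0:ℂ) (1/2), (ENNReal.ofReal (Real.exp |(q * |lpot g x| : ℝ)| - 1) + 1) := by
        refine lintegral_mono fun x => ?_
        rw [abs_of_nonneg (a := q * |lpot g x|) (by positivity), ← ENNReal.ofReal_one,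
          ← ENNReal.ofReal_add _ zero_le_one]
        · simp
        · have := Real.one_le_exp (x := q * |lpot g x|) (by positivity)
          linarith
    _ = (∫⁻ x in ball (0:ℂ) (1/2), ENNReal.ofReal (Real.exp |(q * |lpot g x| : ℝ)| - 1)) + volume (ball (0:ℂ) (1/2)) := by
        rw [lintegral_add_right _ measurable_const, lintegral_const]
        simp
    _ ≤ _ := by
        gcongr
        refine key.trans ?_
        calc _ ≤ B * 1 := by
              gcongr
              rw [integral_div, ENNReal.ofReal_le_one]; exact (div_le_one hε).2 hm
          _ = B := mul_one _


lemma circ_pt {y : ℂ} (hy : ‖y‖ < 1) :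
    ∫⁻ θ in Set.Ioc (0:ℝ) (2 * Real.pi),
      ENNReal.ofReal |Real.log ‖((1/4 : ℝ) : ℂ) * Complex.exp ((θ : ℂ) * Complex.I) - y‖|
      ≤ ENNReal.ofReal (2 * Real.pi * (2 * Real.log 2 - Real.log (1/4))) := by
  have hpi := Real.pi_pos
  have hci : CircleIntegrable (fun z : ℂ => Real.log ‖z - y‖) 0 (1/4) := by
    have := MeromorphicOn.circleIntegrable_log_norm (f := fun z : ℂ => z - y) (c := 0) (R := 1/4)
      (fun z _ => by fun_prop)
    exact this
  have hav := circleAverage_log_norm_sub_const_eq_log_radius_add_posLog (a := y) (c := 0) (R := 1/4) (by norm_num)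
  have hav2 : Real.log (1/4) ≤ Real.circleAverage (fun z : ℂ => Real.log ‖z - y‖) 0 (1/4) := by
    rw [hav]; linarith [Real.posLog_nonneg (x := ((1/4:ℝ)⁻¹ * ‖0 - y‖))]
  rw [Real.circleAverage, smul_eq_mul, inv_mul_eq_div, le_div_iff₀ (by positivity)] at hav2
  unfold CircleIntegrable at hci
  simp only [circleMap, zero_add] at hav2 hci
  have hint : IntervalIntegrable (fun θ : ℝ => 2 * Real.log 2 -
      Real.log ‖((1/4 : ℝ) : ℂ) * Complex.exp ((θ : ℂ) * Complex.I) - y‖) volume 0 (2 * Real.pi) :=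
    intervalIntegrable_const.sub hci
  have hpt : ∀ θ : ℝ, |Real.log ‖((1/4 : ℝ) : ℂ) * Complex.exp ((θ : ℂ) * Complex.I) - y‖| ≤
      2 * Real.log 2 - Real.log ‖((1/4 : ℝ) : ℂ) * Complex.exp ((θ : ℂ) * Complex.I) - y‖ := by
    intro θ
    have hn : ‖((1/4 : ℝ) : ℂ) * Complex.exp ((θ : ℂ) * Complex.I) - y‖ ≤ 2 := by
      refine (norm_sub_le _ _).trans ?_
      rw [norm_mul, Complex.norm_exp_ofReal_mul_I, Complex.norm_real]
      norm_num
      linarith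
    set t := ‖((1/4 : ℝ) : ℂ) * Complex.exp ((θ : ℂ) * Complex.I) - y‖ with ht
    have h2 : 0 < Real.log 2 := Real.log_pos (by norm_num)
    have h3 : Real.log t ≤ Real.log 2 := by
      rcases (norm_nonneg (((1/4 : ℝ) : ℂ) * Complex.exp ((θ : ℂ) * Complex.I) - y)).eq_or_lt with h | h
      · rw [← ht] at h; rw [← h, Real.log_zero]; exact h2.le
      · exact Real.log_le_log h hn
    rcases abs_cases (Real.log t) with ⟨h, _⟩ | ⟨h, _⟩ <;> rw [h] <;> linarith
  calc _ ≤ ∫⁻ θ in Set.Ioc (0:ℝ) (2 * Real.pi), ENNReal.ofReal (2 * Real.log 2 -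
      Real.log ‖((1/4 : ℝ) : ℂ) * Complex.exp ((θ : ℂ) * Complex.I) - y‖) :=
        lintegral_mono fun θ => ENNReal.ofReal_le_ofReal (hpt θ)
    _ = ENNReal.ofReal (∫ θ in (0:ℝ)..(2 * Real.pi), (2 * Real.log 2 -
      Real.log ‖((1/4 : ℝ) : ℂ) * Complex.exp ((θ : ℂ) * Complex.I) - y‖)) := by
        rw [intervalIntegral.integral_of_le (by positivity), ofReal_integral_eq_lintegral_ofReal]
        · exact (intervalIntegrable_iff_integrableOn_Ioc_of_le (by positivity)).1 hint
        · exact Eventually.of_forall fun θ => (abs_nonneg _).trans (hpt θ)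
    _ ≤ _ := by
        refine ENNReal.ofReal_le_ofReal ?_
        rw [intervalIntegral.integral_sub intervalIntegrable_const hci, intervalIntegral.integral_const]
        simp only [smul_eq_mul, sub_zero]
        linarith

lemma circ_lpot : ∃ C : ℝ, 0 ≤ C ∧ ∀ g : ℂ → ℝ, ContDiff ℝ (⊤ : ℕ∞) g → HasCompactSupport g →
      (∀ y, g y ≠ 0 → y ∈ ball (0:ℂ) 1) → ∫ y, |g y| ≤ 1 →
      |circMean (lpot g) (1/4)| ≤ C := by
  have hpi := Real.pi_pos
  set K := 2 * Real.pi * (2 * Real.log 2 - Real.log (1/4)) with hK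
  have hK0 : 0 ≤ K := by
    have h2 : 0 < Real.log 2 := Real.log_pos (by norm_num)
    have h3 : Real.log (1/4) < 0 := Real.log_neg (by norm_num) (by norm_num)
    have : 0 ≤ 2 * Real.log 2 - Real.log (1/4) := by linarith
    positivity
  refine ⟨(2 * Real.pi)⁻¹ * ((2 * Real.pi)⁻¹ * K), by positivity, ?_⟩
  intro g hg hc hs hm
  have hgm := hg.continuous.measurable
  have hgi : Integrable g := hg.continuous.integrable_of_hasCompactSupport hc
  have hvc : Continuous (lpot g) := (lpot_contDiff hg hc).continuous
  set p : ℝ → ℂ := fun θ => ((1/4 : ℝ) : ℂ) * Complex.exp ((θ : ℂ) * Complex.I) with hp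
  have hpc : Continuous p := by fun_prop
  have hpm : Measurable p := hpc.measurable
  have h1 : ∀ θ, ENNReal.ofReal |lpot g (p θ)| ≤
      ENNReal.ofReal (2 * Real.pi)⁻¹ * ∫⁻ y, ENNReal.ofReal (|Real.log ‖p θ - y‖|) * ENNReal.ofReal |g y| := by
    intro θ
    rw [lpot_eq, abs_mul, abs_neg, abs_of_nonneg (a := (2 * Real.pi)⁻¹) (by positivity),
      ENNReal.ofReal_mul (by positivity)]
    gcongr
    have := enorm_integral_le_lintegral_enorm (μ := volume) (fun y => Real.log ‖p θ - y‖ * g y)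
    simp only [← ofReal_norm, Real.norm_eq_abs] at this
    refine this.trans (le_of_eq ?_)
    refine lintegral_congr fun y => ?_
    rw [abs_mul, ENNReal.ofReal_mul (by positivity)]
  have h2 : ∫⁻ θ in Set.Ioc (0:ℝ) (2 * Real.pi), ENNReal.ofReal |lpot g (p θ)|
      ≤ ENNReal.ofReal ((2 * Real.pi)⁻¹ * K) := by
    calc _ ≤ ∫⁻ θ in Set.Ioc (0:ℝ) (2 * Real.pi), ENNReal.ofReal (2 * Real.pi)⁻¹ *
          ∫⁻ y, ENNReal.ofReal (|Real.log ‖p θ - y‖|) * ENNReal.ofReal |g y| :=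
          lintegral_mono fun θ => h1 θ
      _ = ENNReal.ofReal (2 * Real.pi)⁻¹ * ∫⁻ θ in Set.Ioc (0:ℝ) (2 * Real.pi),
          ∫⁻ y, ENNReal.ofReal (|Real.log ‖p θ - y‖|) * ENNReal.ofReal |g y| :=
          lintegral_const_mul' _ _ (by simp)
      _ = ENNReal.ofReal (2 * Real.pi)⁻¹ * ∫⁻ y, ∫⁻ θ in Set.Ioc (0:ℝ) (2 * Real.pi),
          ENNReal.ofReal (|Real.log ‖p θ - y‖|) * ENNReal.ofReal |g y| := by
          congr 1
          refine lintegral_lintegral_swap (Measurable.aemeasurable ?_)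
          unfold Function.uncurry
          fun_prop
      _ ≤ ENNReal.ofReal (2 * Real.pi)⁻¹ * ∫⁻ y, ENNReal.ofReal K * ENNReal.ofReal |g y| := by
          gcongr with y
          rw [lintegral_mul_const _ (by fun_prop)]
          by_cases hy : g y = 0
          · simp [hy]
          · gcongr
            exact circ_pt (mem_ball_zero_iff.1 (hs y hy))
      _ ≤ ENNReal.ofReal (2 * Real.pi)⁻¹ * (ENNReal.ofReal K * 1) := by
          gcongr
          rw [lintegral_const_mul _ (by fun_prop)]
          gcongr
          rw [← ofReal_integral_eq_lintegral_ofReal hgi.abs (Eventually.of_forall fun _ => abs_nonneg _)]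
          simpa using hm
      _ = _ := by rw [mul_one, ← ENNReal.ofReal_mul (by positivity)]
  unfold circMean
  rw [abs_mul, abs_of_nonneg (a := (2 * Real.pi)⁻¹) (by positivity)]
  gcongr
  rw [← ENNReal.ofReal_le_ofReal_iff (by positivity)]
  refine le_trans ?_ h2
  rw [intervalIntegral.integral_of_le (by positivity)]
  have := enorm_integral_le_lintegral_enorm (μ := volume.restrict (Set.Ioc (0:ℝ) (2 * Real.pi)))
    (fun θ => lpot g (p θ))
  simp only [← ofReal_norm, Real.norm_eq_abs] at this
  exact this


lemma log_g_int {g : ℂ → ℝ} (hg : Continuous g) (hc : HasCompactSupport g) (x : ℂ) :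
    Integrable (fun y => Real.log ‖x - y‖ * g y) := by
  have h1 : Integrable (fun y => Real.log ‖y‖ * g (x - y)) := by
    refine int_bdd_mul (k := fun y => Real.log ‖y‖) (f := fun y => g (x - y)) log_int (by fun_prop) ?_
    exact hc.comp_homeomorph (Homeomorph.subLeft x)
  have := h1.comp_sub_left x
  simpa using this

lemma exp_abs_log' {t : ℝ} (ht : 0 < t) : Real.exp |Real.log t| ≤ t + t⁻¹ := by
  have := inv_pos.2 ht
  rcases abs_cases (Real.log t) with ⟨h, _⟩ | ⟨h, _⟩
  · rw [h, Real.exp_log ht]; linarith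
  · rw [h, Real.exp_neg, Real.exp_log ht]; linarith

lemma scaled {L : ℝ} (hL : 1 ≤ L) : ∃ C : ℝ, 0 ≤ C ∧ ∀ g : ℂ → ℝ, Continuous g →
    HasCompactSupport g → ∫ y, |g y| ≤ 1 → ∀ z a : ℂ, a ≠ 0 → ∃ vr : ℝ,
      ∫⁻ w in ball (0:ℂ) L, ENNReal.ofReal (Real.exp |lpot g (z + a * w) - vr| - 1)
        ≤ ENNReal.ofReal (C * ∫ y, |g y|) := by
  have hpi := Real.pi_pos
  have hpi1 : 1 ≤ 2 * Real.pi := by linarith [Real.pi_gt_three]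
  set B : ℝ≥0∞ := 4 * volume (ball (0:ℂ) L) + ENNReal.ofReal (2 * L) *
    ∫⁻ w in ball (0:ℂ) (3 * L), ENNReal.ofReal (‖w‖ ^ (-1:ℝ)) with hB
  have hBt : B < ⊤ := ENNReal.add_lt_top.2
    ⟨ENNReal.mul_lt_top (by simp) measure_ball_lt_top,
      ENNReal.mul_lt_top ENNReal.ofReal_lt_top (ker_lint (by norm_num) _)⟩
  refine ⟨B.toReal, ENNReal.toReal_nonneg, ?_⟩
  intro g hg hc hm z a ha
  have hgi : Integrable g := hg.integrable_of_hasCompactSupport hc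
  have ha' : 0 < ‖a‖ := norm_pos_iff.2 ha
  set M : ℂ → ℝ := fun y => max ‖y - z‖ (‖a‖ * L) with hM
  have hM0 : ∀ y, 0 < M y := fun y => lt_max_of_lt_right (by positivity)
  have hMc : Continuous M := by fun_prop
  have hlM : Continuous fun y => Real.log (M y) := hMc.log fun y => (hM0 y).ne'
  have hlMm := hlM.measurable
  have hMi : Integrable (fun y => Real.log (M y) * g y) :=
    (hlM.mul hg).integrable_of_hasCompactSupport (hc.mul_left)
  refine ⟨-(2 * Real.pi)⁻¹ * ∫ y, Real.log (M y) * g y, ?_⟩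
  have hmass : ∫ y, |g y| / (2 * Real.pi) ≤ ∫ y, |g y| := by
    rw [integral_div]
    exact div_le_self (integral_nonneg fun _ => abs_nonneg _) hpi1
  have key := jt (F := fun w y => |Real.log ‖z + a * w - y‖ - Real.log (M y)|)
    (ρ := fun y => |g y| / (2 * Real.pi))
    (f := fun w => lpot g (z + a * w) - (-(2 * Real.pi)⁻¹ * ∫ y, Real.log (M y) * g y))
    (S := ball (0:ℂ) L) (B := B)
    (hgi.abs.div_const _) (by have := hg.measurable; fun_prop) (fun y => by positivity)
    (hmass.trans hm)
    (fun x y => by positivity) (by unfold Function.uncurry; fun_prop) measurableSet_ball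
    (by
      intro w _
      have h1 : (fun y => |Real.log ‖z + a * w - y‖ - Real.log (M y)| * (|g y| / (2 * Real.pi)))
          = fun y => (2 * Real.pi)⁻¹ * ‖Real.log ‖z + a * w - y‖ * g y - Real.log (M y) * g y‖ := by
        ext y; rw [← sub_mul, norm_mul, Real.norm_eq_abs, Real.norm_eq_abs]; field_simp
      rw [h1, integral_const_mul, lpot_eq, ← mul_sub, abs_mul, abs_neg,
        abs_of_nonneg (a := (2 * Real.pi)⁻¹) (by positivity),
        ← integral_sub (log_g_int hg hc _) hMi]
      gcongr
      exact norm_integral_le_integral_norm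
        (fun y => Real.log ‖z + a * w - y‖ * g y - Real.log (M y) * g y))
    (by
      intro y _
      set y' := (y - z) / a with hy'
      have hxy : ∀ w, ‖z + a * w - y‖ = ‖a‖ * ‖w - y'‖ := by
        intro w; rw [← norm_mul, hy']; congr 1; field_simp; ring
      have hMy : M y = ‖a‖ * max ‖y'‖ L := by
        rw [hM, hy', norm_div, mul_max_of_nonneg _ _ ha'.le, mul_div_cancel₀ _ ha'.ne']
      have hm0 : 0 < max ‖y'‖ L := lt_max_of_lt_right (by linarith)
      have hae : ∀ᵐ w : ℂ, w ≠ y' := by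
        simp [ae_iff]
      have hF : ∀ w, w ≠ y' → w ∈ ball (0:ℂ) L →
          Real.exp |Real.log ‖z + a * w - y‖ - Real.log (M y)| ≤ 2 + max ‖y'‖ L / ‖w - y'‖ := by
        intro w hw hwL
        rw [mem_ball_zero_iff] at hwL
        have hwp : 0 < ‖w - y'‖ := norm_pos_iff.2 (sub_ne_zero.2 hw)
        rw [hxy, hMy, ← Real.log_div (by positivity) (by positivity), mul_div_mul_left _ _ ha'.ne']
        refine (exp_abs_log' (by positivity)).trans ?_
        rw [inv_div]
        gcongr
        rw [div_le_iff₀ hm0]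
        linarith [norm_sub_le w y', le_max_left ‖y'‖ L, le_max_right ‖y'‖ L]
      by_cases hc2 : 2 * L ≤ ‖y'‖
      · calc _ ≤ ∫⁻ w in ball (0:ℂ) L, 4 := by
              refine lintegral_mono_ae ?_
              filter_upwards [ae_restrict_of_ae hae, ae_restrict_mem measurableSet_ball] with w hw hwL
              have h := hF w hw hwL
              rw [mem_ball_zero_iff] at hwL
              have hwp : 0 < ‖w - y'‖ := norm_pos_iff.2 (sub_ne_zero.2 hw)
              have h2 : max ‖y'‖ L / ‖w - y'‖ ≤ 2 := by
                rw [div_le_iff₀ hwp, max_eq_left (by linarith)]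
                have := norm_sub_norm_le y' w
                rw [norm_sub_rev] at this
                linarith
              rw [show (4:ℝ≥0∞) = ENNReal.ofReal 4 by simp]
              exact ENNReal.ofReal_le_ofReal (by linarith)
          _ ≤ B := by rw [lintegral_const, hB]; simp
      · push Not at hc2
        calc _ ≤ ∫⁻ w in ball (0:ℂ) L, (4 + ENNReal.ofReal (2 * L) * ENNReal.ofReal (‖w - y'‖ ^ (-1:ℝ))) := by
              refine lintegral_mono_ae ?_
              filter_upwards [ae_restrict_of_ae hae, ae_restrict_mem measurableSet_ball] with w hw hwL
              have h := hF w hw hwL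
              have hwp : 0 < ‖w - y'‖ := norm_pos_iff.2 (sub_ne_zero.2 hw)
              have h2 : max ‖y'‖ L / ‖w - y'‖ ≤ 2 * L * ‖w - y'‖ ^ (-1:ℝ) := by
                rw [Real.rpow_neg_one, ← div_eq_mul_inv]
                gcongr
                exact max_le hc2.le (by linarith)
              rw [show (4:ℝ≥0∞) = ENNReal.ofReal 4 by simp, ← ENNReal.ofReal_mul (by positivity),
                ← ENNReal.ofReal_add (by norm_num) (by positivity)]
              exact ENNReal.ofReal_le_ofReal (by linarith)
          _ ≤ B := by
              rw [lintegral_add_left (by fun_prop), lintegral_const, hB,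
                lintegral_const_mul _ (by fun_prop)]
              simp only [Measure.restrict_apply MeasurableSet.univ, Set.univ_inter]
              refine add_le_add le_rfl (mul_le_mul_right ?_ _)
              refine trans_le (f := fun w => ENNReal.ofReal (‖w‖ ^ (-1:ℝ))) measurableSet_ball measurableSet_ball ?_
              intro x hx
              rw [mem_ball_zero_iff] at hx ⊢
              linarith [norm_sub_le x y'])
  refine key.trans ?_
  rw [ENNReal.ofReal_mul ENNReal.toReal_nonneg, ENNReal.ofReal_toReal hBt.ne]
  gcongr


lemma blow {H : ℂ → ℂ} (hH : DifferentiableOn ℂ H (ball 0 (3/4))) {R L : ℝ} (hL : 1 ≤ L)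
    (hLR : 3 * L ^ 2 ≤ R) {z1 : ℂ} (hz1 : ‖z1‖ ≤ 5/8)
    (hbig : 2 * R ≤ (5/8 - ‖z1‖) * ‖deriv H z1‖) :
    ∃ z0 a : ℂ, a ≠ 0 ∧ ∀ w ∈ ball (0:ℂ) L, z0 + a * w ∈ ball (0:ℂ) (5/8) ∧
      |(H (z0 + a * w)).re - (H z0).re - w.re| ≤ 1 := by
  have hR : L ≤ R := by nlinarith
  have hR0 : 0 < R := by linarith
  have hF : DifferentiableOn ℂ (deriv H) (ball 0 (3/4)) := hH.deriv isOpen_ball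
  have hsub : closedBall (0:ℂ) (5/8) ⊆ ball 0 (3/4) := closedBall_subset_ball (by norm_num)
  have hcont : ContinuousOn (fun z => (5/8 - ‖z‖) * ‖deriv H z‖) (closedBall (0:ℂ) (5/8)) := by
    have := (hF.continuousOn.mono hsub).norm
    fun_prop
  obtain ⟨z0, hz0, hmax⟩ := (isCompact_closedBall (0:ℂ) (5/8)).exists_isMaxOn ⟨0, by simp; norm_num⟩ hcont
  have hmax' : ∀ z, ‖z‖ ≤ 5/8 → (5/8 - ‖z‖) * ‖deriv H z‖ ≤ (5/8 - ‖z0‖) * ‖deriv H z0‖ :=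
    fun z hz => hmax (by simpa using hz)
  have hm := hbig.trans (hmax' z1 hz1)
  rw [mem_closedBall_zero_iff] at hz0
  set d := 5/8 - ‖z0‖ with hd
  have hd0 : 0 < d := by
    rcases (sub_nonneg.2 hz0).eq_or_lt with h | h
    · rw [hd, ← h] at hm; linarith
    · exact h
  set b := deriv H z0 with hb
  have hb0 : 0 < ‖b‖ := by
    rcases (norm_nonneg b).eq_or_lt with h | h
    · rw [← h] at hm; linarith
    · exact h
  have hbne : b ≠ 0 := norm_pos_iff.1 hb0
  have hin : ∀ w : ℂ, ‖w‖ < R → ‖z0 + b⁻¹ * w‖ < 5/8 - d/2 := by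
    intro w hw
    have h1 : ‖b⁻¹ * w‖ < d / 2 := by
      rw [norm_mul, norm_inv, inv_mul_eq_div, div_lt_iff₀ hb0]
      linarith
    linarith [norm_add_le z0 (b⁻¹ * w)]
  have hF2 : ∀ w : ℂ, ‖w‖ < R → ‖b⁻¹ * deriv H (z0 + b⁻¹ * w)‖ ≤ 2 := by
    intro w hw
    have h1 := hin w hw
    have h2 := hmax' (z0 + b⁻¹ * w) (by linarith)
    rw [norm_mul, norm_inv, inv_mul_eq_div, div_le_iff₀ hb0]
    have h3 : d / 2 * ‖deriv H (z0 + b⁻¹ * w)‖ ≤ d * ‖b‖ := by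
      refine le_trans ?_ h2
      gcongr
      linarith
    by_contra hcon
    push Not at hcon
    nlinarith
  have hmaps : ∀ w ∈ ball (0:ℂ) R, z0 + b⁻¹ * w ∈ ball (0:ℂ) (3/4) := fun w hw => by
    rw [mem_ball_zero_iff] at hw ⊢
    linarith [hin w hw]
  have hsch : ∀ w : ℂ, ‖w‖ < R → ‖b⁻¹ * deriv H (z0 + b⁻¹ * w) - 1‖ ≤ 3 / R * ‖w‖ := by
    intro w hw
    have h1 : DifferentiableOn ℂ (fun w => b⁻¹ * deriv H (z0 + b⁻¹ * w)) (ball 0 R) := by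
      refine DifferentiableOn.const_mul ?_ _
      exact hF.comp (f := fun w => z0 + b⁻¹ * w) (by fun_prop) hmaps
    have h0 : b⁻¹ * deriv H (z0 + b⁻¹ * 0) = 1 := by simp [← hb, hbne]
    have h2 := Complex.dist_le_div_mul_dist_of_mapsTo_ball (R₂ := 3) h1 ?_ (mem_ball_zero_iff.2 hw)
    · rw [h0, dist_eq_norm, dist_zero_right] at h2; exact h2
    · intro x hx
      rw [mem_closedBall, h0, dist_eq_norm]
      refine (norm_sub_le _ _).trans ?_
      have := hF2 x (mem_ball_zero_iff.1 hx)
      simp only [norm_one]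
      linarith
  refine ⟨z0, b⁻¹, inv_ne_zero hbne, fun w hw => ⟨?_, ?_⟩⟩
  · rw [mem_ball_zero_iff] at hw ⊢
    linarith [hin w (by linarith)]
  · have hder : ∀ x ∈ ball (0:ℂ) L, HasDerivWithinAt (fun w => H (z0 + b⁻¹ * w) - w)
        (b⁻¹ * deriv H (z0 + b⁻¹ * x) - 1) (ball 0 L) x := by
      intro x hx
      have hx' : x ∈ ball (0:ℂ) R := ball_subset_ball hR hx
      have h1 : HasDerivAt H (deriv H (z0 + b⁻¹ * x)) (z0 + b⁻¹ * x) :=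
        (hH.differentiableAt (isOpen_ball.mem_nhds (hmaps x hx'))).hasDerivAt
      have h2 : HasDerivAt (fun w : ℂ => z0 + b⁻¹ * w) b⁻¹ x := by
        simpa using ((hasDerivAt_id x).const_mul b⁻¹).const_add z0
      have h3 := (h1.comp x h2).sub (hasDerivAt_id x)
      rw [mul_comm] at h3
      exact h3.hasDerivWithinAt
    have h4 := Convex.norm_image_sub_le_of_norm_hasDerivWithin_le (C := 3 / R * L) hder ?_
      (convex_ball 0 L) (mem_ball_self (by linarith)) hw
    · rw [mem_ball_zero_iff] at hw
      have h5 : 3 / R * L * ‖w - 0‖ ≤ 1 := by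
        rw [sub_zero]
        calc 3 / R * L * ‖w‖ ≤ 3 / R * L * L := by gcongr
          _ = 3 * L ^ 2 / R := by ring
          _ ≤ 1 := (div_le_one hR0).2 hLR
      have h6 := (Complex.abs_re_le_norm _).trans (h4.trans h5)
      simp only [mul_zero, add_zero, sub_zero, Complex.sub_re] at h6
      rwa [show (H (z0 + b⁻¹ * w)).re - (H z0).re - w.re = (H (z0 + b⁻¹ * w)).re - w.re - (H z0).re by ring]
    · intro x hx
      rw [mem_ball_zero_iff] at hx
      refine (hsch x (by linarith)).trans ?_
      gcongr


lemma vol_rect (a b c d : ℝ) : volume {z : ℂ | z.re ∈ Set.Icc a b ∧ z.im ∈ Set.Icc c d}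
    = ENNReal.ofReal (b - a) * ENNReal.ofReal (d - c) := by
  have h : {z : ℂ | z.re ∈ Set.Icc a b ∧ z.im ∈ Set.Icc c d}
      = Complex.measurableEquivRealProd ⁻¹' (Set.Icc a b ×ˢ Set.Icc c d) := by
    ext z; simp [Complex.measurableEquivRealProd]; tauto
  rw [h, Complex.volume_preserving_equiv_real_prod.measure_preimage
    (measurableSet_Icc.prod measurableSet_Icc).nullMeasurableSet, Measure.volume_eq_prod,
    Measure.prod_prod, Real.volume_Icc, Real.volume_Icc]

lemma meas_rect (a b c d : ℝ) :
    MeasurableSet {z : ℂ | z.re ∈ Set.Icc a b ∧ z.im ∈ Set.Icc c d} := by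
  refine MeasurableSet.inter (s₁ := {z : ℂ | z.re ∈ Set.Icc a b}) ?_ ?_
  · exact Complex.measurable_re measurableSet_Icc
  · exact Complex.measurable_im measurableSet_Icc

lemma vol_affine {a : ℂ} (ha : a ≠ 0) (b : ℂ) (G : Set ℂ) :
    volume {x : ℂ | a⁻¹ * x + b ∈ G} = ENNReal.ofReal (‖a‖ ^ 2) * volume G := by
  have h1 : {x : ℂ | a⁻¹ * x + b ∈ G} = (Algebra.lmul ℝ ℂ a⁻¹) ⁻¹' ((fun x => x + b) ⁻¹' G) := by
    ext x; simp
  have h2 : LinearMap.det (Algebra.lmul ℝ ℂ a⁻¹) = (‖a‖ ^ 2)⁻¹ := by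
    rw [← Algebra.norm_apply, Algebra.norm_complex_apply, Complex.normSq_eq_norm_sq, norm_inv, inv_pow]
  have ha' : 0 < ‖a‖ := norm_pos_iff.2 ha
  rw [h1, Measure.addHaar_preimage_linearMap _ (by rw [h2]; positivity), h2, inv_inv,
    abs_of_nonneg (by positivity), measure_preimage_add_right]

def gam (Y : ℝ) (p : ℂ) (s : ℝ) : ℂ := (s : ℂ) * p - ((4 * Y * s * (1 - s) : ℝ) : ℂ)

lemma good_set {Y : ℝ} (hY : 4 ≤ Y) {f : ℂ → ℝ≥0∞} (hf : Measurable f)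
    (hE : ∫⁻ x, f x ≤ ENNReal.ofReal (1 / Y ^ 2)) :
    ∃ τ ∈ {z : ℂ | z.re ∈ Set.Icc (-1:ℝ) 0 ∧ z.im ∈ Set.Icc (0:ℝ) 1},
    ∃ G ⊆ {z : ℂ | z.re ∈ Set.Icc (-1:ℝ) 0 ∧ z.im ∈ Set.Icc (0:ℝ) Y}, MeasurableSet G ∧
      ENNReal.ofReal (Y / 2) ≤ volume G ∧ ∀ p ∈ G, f (τ + p) < 1 ∧
        ∫⁻ s in Set.Icc (0:ℝ) 1, f (τ + gam Y p s) ≤ ENNReal.ofReal (1 / Y) := by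
  set Q := {z : ℂ | z.re ∈ Set.Icc (-1:ℝ) 0 ∧ z.im ∈ Set.Icc (0:ℝ) 1} with hQ
  set P := {z : ℂ | z.re ∈ Set.Icc (-1:ℝ) 0 ∧ z.im ∈ Set.Icc (0:ℝ) Y} with hP
  have hQm : MeasurableSet Q := meas_rect _ _ _ _
  have hPm : MeasurableSet P := meas_rect _ _ _ _
  have hQv : volume Q = 1 := by rw [hQ, vol_rect]; simp
  have hPv : volume P = ENNReal.ofReal Y := by rw [hP, vol_rect]; simp
  have hY0 : 0 < Y := by linarith
  have : IsFiniteMeasure (volume.restrict P) := ⟨by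
    rw [Measure.restrict_apply MeasurableSet.univ, Set.univ_inter, hPv]; exact ENNReal.ofReal_lt_top⟩
  set μ : Measure (ℂ × ℝ) := (volume.restrict P).prod (volume.restrict (Set.Icc (0:ℝ) 1)) with hμ
  have hμu : μ Set.univ = ENNReal.ofReal Y := by
    rw [hμ, ← Set.univ_prod_univ, Measure.prod_prod, Measure.restrict_apply MeasurableSet.univ,
      Measure.restrict_apply MeasurableSet.univ]
    simp [hPv]
  have hg : Measurable fun x : ℂ × ℝ => gam Y x.1 x.2 := by
    unfold gam; fun_prop
  have hm3 : Measurable (Function.uncurry fun (τ : ℂ) (x : ℂ × ℝ) => f (τ + gam Y x.1 x.2)) := by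
    unfold Function.uncurry
    have : Measurable fun q : ℂ × (ℂ × ℝ) => gam Y q.2.1 q.2.2 := hg.comp measurable_snd
    exact hf.comp (measurable_fst.add this)
  have hT : ∫⁻ τ in Q, ∫⁻ x, f (τ + gam Y x.1 x.2) ∂μ ≤ ENNReal.ofReal (1 / Y) := by
    rw [lintegral_lintegral_swap hm3.aemeasurable]
    calc _ ≤ ∫⁻ x, ENNReal.ofReal (1 / Y ^ 2) ∂μ := by
          refine lintegral_mono fun x => ?_
          refine (setLIntegral_le_lintegral _ _).trans ?_
          rw [lintegral_add_right_eq_self f]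
          exact hE
      _ = _ := by
          rw [lintegral_const, hμu, ← ENNReal.ofReal_mul (by positivity)]
          congr 1
          field_simp
  obtain ⟨τ, hτ, hτ2⟩ := exists_le_setLAverage (μ := volume) (s := Q)
    (f := fun τ => ∫⁻ x, f (τ + gam Y x.1 x.2) ∂μ) (by rw [hQv]; simp) (by rw [hQv]; simp)
    hm3.lintegral_prod_right.aemeasurable
  rw [setLAverage_eq, hQv, div_one] at hτ2
  replace hτ2 := hτ2.trans hT
  have hm2 : Measurable fun x : ℂ × ℝ => f (τ + gam Y x.1 x.2) := hf.comp (measurable_const.add hg)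
  rw [hμ, lintegral_prod _ hm2.aemeasurable] at hτ2
  set J : ℂ → ℝ≥0∞ := fun p => ∫⁻ s in Set.Icc (0:ℝ) 1, f (τ + gam Y p s) with hJ
  have hJm : Measurable J := hm2.lintegral_prod_right
  have hft : Measurable fun p => f (τ + p) := hf.comp (measurable_const.add measurable_id)
  have hb1 : volume ({p | ENNReal.ofReal (1 / Y) ≤ J p} ∩ P) ≤ 1 := by
    have h := (mul_meas_ge_le_lintegral (μ := volume.restrict P) hJm (ENNReal.ofReal (1 / Y))).trans hτ2
    rw [Measure.restrict_apply (measurableSet_le measurable_const hJm)] at h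
    have h0 : ENNReal.ofReal (1 / Y) ≠ 0 := by
      rw [Ne, ENNReal.ofReal_eq_zero, not_le]; positivity
    rw [← ENNReal.mul_le_mul_iff_right h0 ENNReal.ofReal_ne_top, mul_one]
    exact h
  have hb2 : volume {p | 1 ≤ f (τ + p)} ≤ 1 := by
    have h := mul_meas_ge_le_lintegral (μ := volume) hft 1
    rw [lintegral_add_left_eq_self f, one_mul] at h
    refine h.trans (hE.trans ?_)
    rw [ENNReal.ofReal_le_one, div_le_one (by positivity)]
    nlinarith
  refine ⟨τ, hτ, P \ ({p | ENNReal.ofReal (1 / Y) ≤ J p} ∪ {p | 1 ≤ f (τ + p)}),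
    Set.sdiff_subset, hPm.diff ((measurableSet_le measurable_const hJm).union
      (measurableSet_le measurable_const hft)), ?_, ?_⟩
  · set G := P \ ({p | ENNReal.ofReal (1 / Y) ≤ J p} ∪ {p | 1 ≤ f (τ + p)}) with hG
    have hcov : P ⊆ G ∪ (({p | ENNReal.ofReal (1 / Y) ≤ J p} ∩ P) ∪ {p | 1 ≤ f (τ + p)}) := by
      intro p hp
      by_cases h1 : ENNReal.ofReal (1 / Y) ≤ J p
      · exact Or.inr (Or.inl ⟨h1, hp⟩)
      · by_cases h2 : 1 ≤ f (τ + p)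
        · exact Or.inr (Or.inr h2)
        · exact Or.inl ⟨hp, fun h => h.elim h1 h2⟩
    have h1 : ENNReal.ofReal Y ≤ volume G + (1 + 1) := by
      rw [← hPv]
      refine (measure_mono hcov).trans ((measure_union_le _ _).trans ?_)
      gcongr
      exact (measure_union_le _ _).trans (add_le_add hb1 hb2)
    have h2 : ENNReal.ofReal (Y / 2) + (1 + 1) ≤ volume G + (1 + 1) := by
      refine le_trans ?_ h1
      rw [show (1 + 1 : ℝ≥0∞) = ENNReal.ofReal 2 by norm_num, ← ENNReal.ofReal_add (by positivity) (by norm_num)]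
      exact ENNReal.ofReal_le_ofReal (by linarith)
    exact (ENNReal.add_le_add_iff_right (by simp)).1 h2
  · rintro p ⟨_, hp⟩
    simp only [Set.mem_union, Set.mem_ofPred_eq, not_or, not_le] at hp
    exact ⟨hp.2, hp.1.le⟩


lemma gam_norm {Y : ℝ} (hY : 4 ≤ Y) {τ p : ℂ} (hτ : τ.re ∈ Set.Icc (-1:ℝ) 0 ∧ τ.im ∈ Set.Icc (0:ℝ) 1)
    (hp : p.re ∈ Set.Icc (-1:ℝ) 0 ∧ p.im ∈ Set.Icc (0:ℝ) Y) {s : ℝ} (hs : s ∈ Set.Icc (0:ℝ) 1) :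
    ‖τ + gam Y p s‖ < 5 * Y := by
  obtain ⟨⟨h1, h2⟩, h3, h4⟩ := hτ
  obtain ⟨⟨h5, h6⟩, h7, h8⟩ := hp
  obtain ⟨h9, h10⟩ := hs
  have a1 : ‖τ‖ ≤ 2 := by
    refine (Complex.norm_le_abs_re_add_abs_im τ).trans ?_
    rw [abs_of_nonpos h2, abs_of_nonneg h3]; linarith
  have a2 : ‖p‖ ≤ 1 + Y := by
    refine (Complex.norm_le_abs_re_add_abs_im p).trans ?_
    rw [abs_of_nonpos h6, abs_of_nonneg h7]; linarith
  have a3 : ‖gam Y p s‖ ≤ (1 + Y) + Y := by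
    unfold gam
    refine (norm_sub_le _ _).trans ?_
    rw [norm_mul, Complex.norm_real, Complex.norm_real, Real.norm_of_nonneg h9,
      Real.norm_of_nonneg (mul_nonneg (by positivity) (by linarith))]
    have : s * ‖p‖ ≤ 1 * (1 + Y) := by gcongr
    nlinarith [sq_nonneg (2 * s - 1)]
  linarith [norm_add_le τ (gam Y p s)]

lemma gam_re (Y : ℝ) (p : ℂ) (s : ℝ) : (gam Y p s).re = s * p.re - 4 * Y * s * (1 - s) := by
  unfold gam
  rw [Complex.sub_re, Complex.ofReal_re, Complex.re_ofReal_mul]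

lemma gam_deriv (Y : ℝ) (p : ℂ) (s : ℝ) :
    HasDerivAt (gam Y p) (p - ((4 * Y * (1 - 2 * s) : ℝ) : ℂ)) s := by
  have h1 : HasDerivAt (fun s : ℝ => (s : ℂ) * p) (1 * p) s :=
    (Complex.ofRealCLM.hasDerivAt (x := s)).mul_const p
  have h2 : HasDerivAt (fun s : ℝ => 4 * Y * s * (1 - s)) (4 * Y * (1 - 2 * s)) s := by
    have := ((hasDerivAt_id s).const_mul (4 * Y)).mul ((hasDerivAt_id s).const_sub 1)
    refine this.congr_deriv ?_
    simp; ring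
  have h3 := h1.sub h2.ofReal_comp
  rw [one_mul] at h3
  exact h3

lemma exp_int {Y : ℝ} (hY : 4 ≤ Y) :
    ∫ t in (0:ℝ)..1, (Real.exp (-2 * Y * t) + Real.exp (-2 * Y * (1 - t))) ≤ 1 / Y := by
  have hY0 : 0 < Y := by linarith
  have hd : ∀ t ∈ Set.uIcc (0:ℝ) 1, HasDerivAt (fun t => (2 * Y)⁻¹ *
      (Real.exp (-2 * Y * (1 - t)) - Real.exp (-2 * Y * t)))
      (Real.exp (-2 * Y * t) + Real.exp (-2 * Y * (1 - t))) t := by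
    intro t _
    have h1 := (((hasDerivAt_id t).const_sub 1).const_mul (-2 * Y)).exp
    have h2 := ((hasDerivAt_id t).const_mul (-2 * Y)).exp
    refine ((h1.sub h2).const_mul (2 * Y)⁻¹).congr_deriv ?_
    simp only [id]
    field_simp
    ring
  rw [intervalIntegral.integral_eq_sub_of_hasDerivAt hd (by apply Continuous.intervalIntegrable; fun_prop)]
  simp only [sub_self, mul_zero, Real.exp_zero, mul_one, sub_zero]
  have := Real.exp_pos (-2 * Y)
  rw [← mul_sub, inv_mul_eq_div, div_le_div_iff₀ (by positivity) hY0]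
  nlinarith

lemma len_bound {u : ℂ → ℝ} {Y : ℝ} (hY : 4 ≤ Y) {z0 a : ℂ}
    {κ : ℝ} {Ψ : ℂ → ℝ} (hΨc : Continuous Ψ) (hΨ0 : ∀ w, 0 ≤ Ψ w)
    (hest : ∀ w ∈ ball (0:ℂ) (5 * Y), |u (z0 + a * w) - κ - w.re| ≤ 1 + Ψ w)
    {τ p : ℂ} (hτ : τ.re ∈ Set.Icc (-1:ℝ) 0 ∧ τ.im ∈ Set.Icc (0:ℝ) 1)
    (hp : p.re ∈ Set.Icc (-1:ℝ) 0 ∧ p.im ∈ Set.Icc (0:ℝ) Y)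
    (hJ : ∫⁻ s in Set.Icc (0:ℝ) 1, ENNReal.ofReal (Real.exp (Ψ (τ + gam Y p s)) - 1)
      ≤ ENNReal.ofReal (1 / Y)) :
    confLen u (fun s => z0 + a * (τ + gam Y p s)) ≤ 12 * Real.exp 1 * (‖a‖ * Real.exp κ) := by
  have hY0 : 0 < Y := by linarith
  have hgc : Continuous (gam Y p) := by unfold gam; fun_prop
  have hηc : Continuous fun s => Real.exp (Ψ (τ + gam Y p s)) - 1 := by fun_prop
  have hη0 : ∀ s, 0 ≤ Real.exp (Ψ (τ + gam Y p s)) - 1 := fun s => by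
    linarith [Real.one_le_exp (hΨ0 (τ + gam Y p s))]
  have hJ' : ∫ s in (0:ℝ)..1, (Real.exp (Ψ (τ + gam Y p s)) - 1) ≤ 1 / Y := by
    rw [intervalIntegral.integral_of_le zero_le_one, ← integral_Icc_eq_integral_Ioc,
      ← ENNReal.ofReal_le_ofReal_iff (by positivity), ofReal_integral_eq_lintegral_ofReal]
    · exact hJ
    · exact hηc.continuousOn.integrableOn_Icc
    · exact Eventually.of_forall hη0
  set k := ‖a‖ * Real.exp κ with hk
  have hk0 : 0 ≤ k := by positivity
  have hder : ∀ s, deriv (fun s => z0 + a * (τ + gam Y p s)) s = a * (p - ((4 * Y * (1 - 2 * s) : ℝ) : ℂ)) :=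
    fun s => ((((gam_deriv Y p s).const_add τ).const_mul a).const_add z0).deriv
  have a2 : ‖p‖ ≤ 1 + Y := by
    refine (Complex.norm_le_abs_re_add_abs_im p).trans ?_
    rw [abs_of_nonpos hp.1.2, abs_of_nonneg hp.2.1]; linarith [hp.1.1, hp.2.2]
  have hpt : ∀ s ∈ Set.Ioc (0:ℝ) 1, Real.exp (u (z0 + a * (τ + gam Y p s))) *
      ‖deriv (fun s => z0 + a * (τ + gam Y p s)) s‖ ≤ (6 * Y * Real.exp 1 * k) *
        ((Real.exp (-2 * Y * s) + Real.exp (-2 * Y * (1 - s))) + (Real.exp (Ψ (τ + gam Y p s)) - 1)) := by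
    intro s hs
    have hs' : s ∈ Set.Icc (0:ℝ) 1 := ⟨hs.1.le, hs.2⟩
    rw [hder, norm_mul]
    have b1 : ‖p - ((4 * Y * (1 - 2 * s) : ℝ) : ℂ)‖ ≤ 6 * Y := by
      refine (norm_sub_le _ _).trans ?_
      rw [Complex.norm_real, Real.norm_eq_abs, abs_mul, abs_of_nonneg (by positivity : 0 ≤ 4 * Y)]
      have : |1 - 2 * s| ≤ 1 := by rw [abs_le]; constructor <;> linarith [hs.1, hs.2]
      nlinarith
    have b2 := (abs_le.1 (hest _ (mem_ball_zero_iff.2 (gam_norm hY hτ hp hs')))).2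
    rw [Complex.add_re, gam_re] at b2
    have b3 : u (z0 + a * (τ + gam Y p s)) ≤ κ + 1 + -(4 * Y * s * (1 - s)) + Ψ (τ + gam Y p s) := by
      have : s * p.re ≤ 0 := mul_nonpos_of_nonneg_of_nonpos hs.1.le hp.1.2
      linarith [hτ.1.2]
    have b4 : Real.exp (-(4 * Y * s * (1 - s))) ≤ Real.exp (-2 * Y * s) + Real.exp (-2 * Y * (1 - s)) := by
      rcases le_total s (1/2) with h | h
      · have : Real.exp (-(4 * Y * s * (1 - s))) ≤ Real.exp (-2 * Y * s) := by
          refine Real.exp_le_exp.2 ?_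
          nlinarith [mul_nonneg (mul_nonneg hY0.le hs.1.le) (by linarith : 0 ≤ 1 - 2 * s)]
        linarith [Real.exp_pos (-2 * Y * (1 - s))]
      · have : Real.exp (-(4 * Y * s * (1 - s))) ≤ Real.exp (-2 * Y * (1 - s)) := by
          refine Real.exp_le_exp.2 ?_
          nlinarith [mul_nonneg (mul_nonneg hY0.le (sub_nonneg.2 hs.2)) (by linarith : 0 ≤ 2 * s - 1)]
        linarith [Real.exp_pos (-2 * Y * s)]
    have b5 : Real.exp (-(4 * Y * s * (1 - s))) ≤ 1 := by
      rw [Real.exp_le_one_iff]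
      have : 0 ≤ 4 * Y * s * (1 - s) := mul_nonneg (mul_nonneg (by positivity) hs.1.le) (sub_nonneg.2 hs.2)
      linarith
    set η := Real.exp (Ψ (τ + gam Y p s)) - 1 with hη
    have b6 : Real.exp (u (z0 + a * (τ + gam Y p s))) ≤
        Real.exp κ * Real.exp 1 * ((Real.exp (-2 * Y * s) + Real.exp (-2 * Y * (1 - s))) + η) := by
      refine (Real.exp_le_exp.2 b3).trans ?_
      rw [Real.exp_add, Real.exp_add, Real.exp_add, mul_assoc]
      gcongr
      rw [show Real.exp (Ψ (τ + gam Y p s)) = 1 + η by rw [hη]; ring]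
      nlinarith [hη0 s]
    calc _ ≤ (Real.exp κ * Real.exp 1 * ((Real.exp (-2 * Y * s) + Real.exp (-2 * Y * (1 - s))) + η)) *
          (‖a‖ * (6 * Y)) := by
          gcongr
          exact (Real.exp_pos _).le.trans b6
      _ = _ := by rw [hk]; ring
  unfold confLen
  have hci : IntervalIntegrable (fun s => Real.exp (-2 * Y * s) + Real.exp (-2 * Y * (1 - s))) volume 0 1 := by
    apply Continuous.intervalIntegrable; fun_prop
  calc _ ≤ ∫ s in (0:ℝ)..1, (6 * Y * Real.exp 1 * k) *
        ((Real.exp (-2 * Y * s) + Real.exp (-2 * Y * (1 - s))) + (Real.exp (Ψ (τ + gam Y p s)) - 1)) := by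
        rw [intervalIntegral.integral_of_le zero_le_one, intervalIntegral.integral_of_le zero_le_one]
        refine integral_mono_of_nonneg (Eventually.of_forall fun s => by positivity) ?_ ?_
        · refine (intervalIntegrable_iff_integrableOn_Ioc_of_le zero_le_one).1 ?_
          apply Continuous.intervalIntegrable; fun_prop
        · filter_upwards [ae_restrict_mem measurableSet_Ioc] with s hs
          exact hpt s hs
    _ = (6 * Y * Real.exp 1 * k) * ((∫ s in (0:ℝ)..1, (Real.exp (-2 * Y * s) + Real.exp (-2 * Y * (1 - s))))
          + ∫ s in (0:ℝ)..1, (Real.exp (Ψ (τ + gam Y p s)) - 1)) := by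
        rw [intervalIntegral.integral_const_mul, intervalIntegral.integral_add hci (hηc.intervalIntegrable _ _)]
    _ ≤ (6 * Y * Real.exp 1 * k) * (1 / Y + 1 / Y) := by
        gcongr
        exact exp_int hY
    _ = _ := by field_simp; ring


lemma geo {u : ℂ → ℝ} {Y : ℝ} (hY : 4 ≤ Y) {z0 a : ℂ} (ha : a ≠ 0)
    {κ : ℝ} {Ψ : ℂ → ℝ} (hΨc : Continuous Ψ) (hΨ0 : ∀ w, 0 ≤ Ψ w)
    (hin : ∀ w ∈ ball (0:ℂ) (5 * Y), z0 + a * w ∈ ball (0:ℂ) (5/8))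
    (hest : ∀ w ∈ ball (0:ℂ) (5 * Y), |u (z0 + a * w) - κ - w.re| ≤ 1 + Ψ w)
    (hE : ∫⁻ w in ball (0:ℂ) (5 * Y), ENNReal.ofReal (Real.exp (Ψ w) - 1) ≤ ENNReal.ofReal (1 / Y ^ 2)) :
    ∃ z ∈ ball (0:ℂ) (3/4), ENNReal.ofReal ((‖a‖ * Real.exp κ) ^ 2 * (Y * Real.exp (-6) / 8)) ≤
      confAreaE u (confBall u (ball (0:ℂ) 1) z (40 * (‖a‖ * Real.exp κ))) := by
  have ha' : 0 < ‖a‖ := norm_pos_iff.2 ha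
  have hY0 : 0 < Y := by linarith
  set f : ℂ → ℝ≥0∞ := (ball (0:ℂ) (5 * Y)).indicator (fun w => ENNReal.ofReal (Real.exp (Ψ w) - 1)) with hf
  have hfm : Measurable f := by
    refine Measurable.indicator ?_ measurableSet_ball
    have := hΨc.measurable
    fun_prop
  have hf1 : ∀ w ∈ ball (0:ℂ) (5 * Y), f w = ENNReal.ofReal (Real.exp (Ψ w) - 1) := fun w hw => by
    rw [hf, Set.indicator_of_mem hw]
  have hfE : ∫⁻ x, f x ≤ ENNReal.ofReal (1 / Y ^ 2) := by
    rw [hf, lintegral_indicator measurableSet_ball]; exact hE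
  obtain ⟨τ, hτ, G, hGP, hGm, hGv, hG⟩ := good_set hY hfm hfE
  have hg0 : ∀ p, gam Y p 0 = 0 := fun p => by simp [gam]
  have hg1 : ∀ p, gam Y p 1 = p := fun p => by simp [gam]
  have hmem : ∀ p ∈ G, ∀ s ∈ Set.Icc (0:ℝ) 1, τ + gam Y p s ∈ ball (0:ℂ) (5 * Y) := fun p hp s hs =>
    mem_ball_zero_iff.2 (gam_norm hY hτ (hGP hp) hs)
  have hmem1 : ∀ p ∈ G, τ + p ∈ ball (0:ℂ) (5 * Y) := fun p hp => by
    have := hmem p hp 1 ⟨zero_le_one, le_rfl⟩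
    rwa [hg1] at this
  have hk0 : 0 < ‖a‖ * Real.exp κ := by positivity
  have hsub : ball (0:ℂ) (5/8) ⊆ ball 0 1 := ball_subset_ball (by norm_num)
  have hτL : τ ∈ ball (0:ℂ) (5 * Y) := by
    have h := gam_norm (Y := Y) (p := 0) (s := 0) hY hτ (by simp; linarith) (by simp)
    rw [hg0, add_zero] at h
    exact mem_ball_zero_iff.2 h
  refine ⟨z0 + a * τ, ball_subset_ball (by norm_num) (hin τ hτL), ?_⟩
  set S : Set ℂ := {x | a⁻¹ * x + (-(a⁻¹ * z0) - τ) ∈ G} with hS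
  have hx : ∀ x, z0 + a * (τ + (a⁻¹ * x + (-(a⁻¹ * z0) - τ))) = x := fun x => by
    field_simp; ring
  have hSm : MeasurableSet S := by
    have : Measurable fun x : ℂ => a⁻¹ * x + (-(a⁻¹ * z0) - τ) := by fun_prop
    exact this hGm
  have hSv := vol_affine ha (-(a⁻¹ * z0) - τ) G
  have hSB : S ⊆ confBall u (ball (0:ℂ) 1) (z0 + a * τ) (40 * (‖a‖ * Real.exp κ)) := by
    intro x hxS
    set p := a⁻¹ * x + (-(a⁻¹ * z0) - τ) with hp
    have hpG : p ∈ G := hxS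
    have hxp : z0 + a * (τ + p) = x := hx x
    have hlen : confLen u (fun s => z0 + a * (τ + gam Y p s)) ≤ 12 * Real.exp 1 * (‖a‖ * Real.exp κ) := by
      refine len_bound hY hΨc hΨ0 hest hτ (hGP hpG) ?_
      refine le_trans (le_of_eq ?_) (hG p hpG).2
      refine setLIntegral_congr_fun measurableSet_Icc fun s hs => ?_
      rw [hf1 _ (hmem p hpG s hs)]
    refine ⟨?_, ?_⟩
    · rw [← hxp]; exact hsub (hin _ (hmem1 p hpG))
    · refine lt_of_le_of_lt (csInf_le ?_ ⟨fun s => z0 + a * (τ + gam Y p s), ?_, rfl⟩) (lt_of_le_of_lt hlen ?_)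
      · refine ⟨0, ?_⟩
        rintro _ ⟨γ, _, rfl⟩
        exact intervalIntegral.integral_nonneg zero_le_one fun t _ => by positivity
      · refine ⟨?_, ?_, ?_, ?_⟩
        · simp only [hg0, add_zero]
        · simp only [hg1, hxp]
        · intro t ht
          exact hsub (hin _ (hmem p hpG t ht))
        · unfold gam
          have h1 : ContDiff ℝ 1 (fun s : ℝ => (s : ℂ)) := Complex.ofRealCLM.contDiff
          have h2 : ContDiff ℝ 1 (fun s : ℝ => ((4 * Y * s * (1 - s) : ℝ) : ℂ)) :=
            Complex.ofRealCLM.contDiff.comp (by fun_prop : ContDiff ℝ 1 fun s : ℝ => 4 * Y * s * (1 - s))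
          fun_prop
      · have := Real.exp_one_lt_d9
        nlinarith
  have hlow : ∀ x ∈ S, Real.exp κ ^ 2 * (Real.exp (-6) / 4) ≤ Real.exp (2 * u x) := by
    intro x hxS
    set p := a⁻¹ * x + (-(a⁻¹ * z0) - τ) with hp
    have hpG : p ∈ G := hxS
    have hxp : z0 + a * (τ + p) = x := hx x
    have h1 := (hG p hpG).1
    rw [hf1 _ (hmem1 p hpG), ← ENNReal.ofReal_one, ENNReal.ofReal_lt_ofReal_iff one_pos] at h1
    have h2 := (abs_le.1 (hest _ (hmem1 p hpG))).1
    rw [hxp, Complex.add_re] at h2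
    have h3 : κ - 3 - Ψ (τ + p) ≤ u x := by linarith [hτ.1.1, (hGP hpG).1.1]
    have h4 : 1 / 2 ≤ Real.exp (-Ψ (τ + p)) := by
      rw [Real.exp_neg, one_div]
      exact inv_anti₀ (Real.exp_pos _) (by linarith)
    have h5 : Real.exp κ * Real.exp (-3) * (1 / 2) ≤ Real.exp (u x) := by
      refine le_trans ?_ (Real.exp_le_exp.2 h3)
      rw [sub_eq_add_neg, sub_eq_add_neg, Real.exp_add, Real.exp_add]
      gcongr
    calc _ = (Real.exp κ * Real.exp (-3) * (1 / 2)) ^ 2 := by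
          rw [show (-6:ℝ) = -3 + -3 by norm_num, Real.exp_add]; ring
      _ ≤ Real.exp (u x) ^ 2 := by gcongr
      _ = _ := by rw [← Real.exp_nat_mul]; simp
  unfold confAreaE
  calc _ ≤ ENNReal.ofReal (Real.exp κ ^ 2 * (Real.exp (-6) / 4)) * volume S := by
        rw [hS, hSv]
        calc _ = ENNReal.ofReal (Real.exp κ ^ 2 * (Real.exp (-6) / 4)) *
              (ENNReal.ofReal (‖a‖ ^ 2) * ENNReal.ofReal (Y / 2)) := by
              rw [← ENNReal.ofReal_mul (by positivity), ← ENNReal.ofReal_mul (by positivity)]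
              congr 1; ring
          _ ≤ _ := by gcongr
    _ = ∫⁻ x in S, ENNReal.ofReal (Real.exp κ ^ 2 * (Real.exp (-6) / 4)) := by
        rw [setLIntegral_const]
    _ ≤ ∫⁻ x in S, ENNReal.ofReal (Real.exp (2 * u x)) :=
        setLIntegral_mono' hSm fun x hx => ENNReal.ofReal_le_ofReal (hlow x hx)
    _ ≤ _ := lintegral_mono_set hSB


lemma lap_contDiffAt {u : ℂ → ℝ} {x : ℂ} (hu : ContDiffAt ℝ (⊤ : ℕ∞) u x) :
    ContDiffAt ℝ (⊤ : ℕ∞) (lap u) x := by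
  have h : ContDiffAt ℝ (⊤ : ℕ∞) (iteratedFDeriv ℝ 2 u) x := hu.iteratedFDeriv_right (by simp; rfl)
  have h2 : ∀ m : Fin 2 → ℂ, ContDiffAt ℝ (⊤ : ℕ∞) (fun y => iteratedFDeriv ℝ 2 u y m) x := fun m =>
    (ContinuousMultilinearMap.apply ℝ (fun _ : Fin 2 => ℂ) ℝ m).contDiff.contDiffAt.comp x h
  exact (h2 _).add (h2 _)

lemma decomp {u : ℂ → ℝ} (hu : ContDiffOn ℝ (⊤ : ℕ∞) u (ball (0:ℂ) 1)) {ε₀ : ℝ} (hε : 0 ≤ ε₀)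
    (hK : curvIntE u (ball (0:ℂ) 1) ≤ ENNReal.ofReal ε₀) :
    ∃ g : ℂ → ℝ, ContDiff ℝ (⊤ : ℕ∞) g ∧ HasCompactSupport g ∧ (∀ y, g y ≠ 0 → y ∈ ball (0:ℂ) 1) ∧
      ∫ y, |g y| ≤ ε₀ ∧ ∃ H : ℂ → ℂ, DifferentiableOn ℂ H (ball 0 (3/4)) ∧
        (∀ z ∈ ball (0:ℂ) (3/4), u z = lpot g z + (H z).re) ∧
        circMean u (1/4) = circMean (lpot g) (1/4) + (H 0).re := by
  let χ : ContDiffBump (0:ℂ) := ⟨3/4, 7/8, by norm_num, by norm_num⟩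
  have hua : ∀ x ∈ ball (0:ℂ) 1, ContDiffAt ℝ (⊤ : ℕ∞) u x := fun x hx =>
    hu.contDiffAt (isOpen_ball.mem_nhds hx)
  have hχs : tsupport χ = closedBall (0:ℂ) (7/8) := χ.tsupport_eq
  set g : ℂ → ℝ := fun x => -(χ x * lap u x) with hgdef
  have hgz : ∀ x, x ∉ closedBall (0:ℂ) (7/8) → g x = 0 := fun x hx => by
    have : χ x = 0 := by
      rw [← hχs] at hx
      exact image_eq_zero_of_notMem_tsupport hx
    simp [hgdef, this]
  have hg : ContDiff ℝ (⊤ : ℕ∞) g := by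
    rw [contDiff_iff_contDiffAt]
    intro x
    by_cases hx : x ∈ ball (0:ℂ) 1
    · exact (χ.contDiff.contDiffAt.mul (lap_contDiffAt (hua x hx))).neg
    · have hx' : x ∈ (closedBall (0:ℂ) (7/8))ᶜ := fun h => hx (closedBall_subset_ball (by norm_num) h)
      refine (contDiffAt_const (c := (0:ℝ))).congr_of_eventuallyEq ?_
      filter_upwards [isClosed_closedBall.isOpen_compl.mem_nhds hx'] with y hy
      exact hgz y hy
  have hc : HasCompactSupport g := HasCompactSupport.intro (isCompact_closedBall (0:ℂ) (7/8)) hgz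
  have hs : ∀ y, g y ≠ 0 → y ∈ ball (0:ℂ) 1 := fun y hy => by
    by_contra h
    exact hy (hgz y fun h' => h (closedBall_subset_ball (by norm_num) h'))
  have hgi : Integrable g := hg.continuous.integrable_of_hasCompactSupport hc
  refine ⟨g, hg, hc, hs, ?_, ?_⟩
  · rw [← ENNReal.ofReal_le_ofReal_iff hε, ofReal_integral_eq_lintegral_ofReal hgi.abs
      (Eventually.of_forall fun _ => abs_nonneg _)]
    refine le_trans ?_ hK
    unfold curvIntE
    rw [← lintegral_indicator measurableSet_ball]
    refine lintegral_mono fun x => ?_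
    by_cases hx : x ∈ ball (0:ℂ) 1
    · rw [Set.indicator_of_mem hx]
      refine ENNReal.ofReal_le_ofReal ?_
      rw [hgdef, gauss, abs_neg, abs_mul, abs_mul, abs_neg, abs_of_pos (Real.exp_pos _),
        abs_of_nonneg χ.nonneg]
      have h1 : Real.exp (-(2 * u x)) * |lap u x| * Real.exp (2 * u x) = |lap u x| := by
        rw [mul_right_comm, ← Real.exp_add]; simp
      rw [h1]
      exact mul_le_of_le_one_left (abs_nonneg _) χ.le_one
    · have : g x = 0 := by by_contra h; exact hx (hs x h)
      simp [this]
  · have hv := lpot_contDiff hg hc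
    have hsub : ball (0:ℂ) (3/4) ⊆ ball 0 1 := ball_subset_ball (by norm_num)
    have hharm : InnerProductSpace.HarmonicOnNhd (fun x => u x - lpot g x) (ball (0:ℂ) (3/4)) := by
      intro x hx
      refine ⟨((hua x (hsub hx)).of_le two_le_inf).sub (hv.contDiffAt.of_le two_le_inf), ?_⟩
      filter_upwards [isOpen_ball.mem_nhds hx] with y hy
      have h1 : lap (fun x => u x - lpot g x) y = lap u y - lap (lpot g) y := by
        have h2 : iteratedFDeriv ℝ 2 (fun x => u x - lpot g x) y
            = iteratedFDeriv ℝ 2 u y - iteratedFDeriv ℝ 2 (lpot g) y :=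
          iteratedFDeriv_sub_apply ((hua y (hsub hy)).of_le two_le_inf) (hv.contDiffAt.of_le two_le_inf)
        simp only [lap, h2, ContinuousMultilinearMap.sub_apply]
        ring
      have h3 : χ y = 1 := χ.one_of_mem_closedBall (ball_subset_closedBall hy)
      rw [InnerProductSpace.laplacian_eq_iteratedFDeriv_complexPlane]
      change lap (fun x => u x - lpot g x) y = 0
      rw [h1, lap_lpot hg hc, hgdef]
      simp [h3]
    obtain ⟨H, hH, hHe⟩ := hharm.exists_analyticOnNhd_ball_re_eq
    refine ⟨H, hH.differentiableOn, fun z hz => ?_, ?_⟩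
    · have := hHe hz
      simp only at this
      linarith
    · have hav := InnerProductSpace.HarmonicOnNhd.circleAverage_eq (c := 0) (R := 1/4)
        (hharm.mono (closedBall_subset_ball (by norm_num [abs_of_pos])))
      have h0 := hHe (mem_ball_self (by norm_num : (0:ℝ) < 3/4))
      simp only at h0
      rw [h0, ← hav]
      have hcu : Continuous fun θ : ℝ => u (((1/4 : ℝ) : ℂ) * Complex.exp ((θ : ℂ) * Complex.I)) := by
        refine hu.continuousOn.comp_continuous (by fun_prop) fun θ => ?_
        rw [mem_ball_zero_iff, norm_mul, Complex.norm_exp_ofReal_mul_I, Complex.norm_real]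
        norm_num
      have hcv : Continuous fun θ : ℝ => lpot g (((1/4 : ℝ) : ℂ) * Complex.exp ((θ : ℂ) * Complex.I)) :=
        hv.continuous.comp (by fun_prop)
      unfold circMean Real.circleAverage
      simp only [circleMap, zero_add, smul_eq_mul]
      rw [intervalIntegral.integral_sub (hcu.intervalIntegrable _ _) (hcv.intervalIntegrable _ _)]
      ring

/-- exponential integrability `∫_{D_{1/2}} e^{q(u-c)} < C(q, ε₀, Λ₁)`, where `c`
is the mean value of `u` on `∂D_{1/4}`. -/
theorem statement1 (Λ₁ : ℝ) (hΛ₁ : 0 < Λ₁) :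
    ∃ ε₀ : ℝ, 0 < ε₀ ∧ ε₀ < 4 * Real.pi / 3 ∧
      ∀ q : ℝ, 0 < q → q < 4 * Real.pi / ε₀ →
        ∃ C : ℝ, 0 < C ∧
          ∀ u : ℂ → ℝ, ContDiffOn ℝ (⊤ : ℕ∞) u (ball (0:ℂ) 1) →
            (∀ r : ℝ, 0 < r → ∀ z ∈ ball (0:ℂ) (3/4),
              confAreaE u (confBall u (ball (0:ℂ) 1) z r)
                < ENNReal.ofReal (Λ₁ * (Real.pi * r ^ 2))) →
            curvIntE u (ball (0:ℂ) 1) ≤ ENNReal.ofReal ε₀ →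
            (∫⁻ x in ball (0:ℂ) (1/2),
                ENNReal.ofReal (Real.exp (q * (u x - circMean u (1/4)))))
              < ENNReal.ofReal C := by
  have hpi := Real.pi_pos
  set Y : ℝ := 8 * Real.exp 6 * (1600 * Real.pi * Λ₁) + 4 with hYdef
  have hY : 4 ≤ Y := by
    have : 0 ≤ 8 * Real.exp 6 * (1600 * Real.pi * Λ₁) := by positivity
    linarith
  have hY0 : 0 < Y := by linarith
  have hYe : 1600 * Real.pi * Λ₁ ≤ Y * Real.exp (-6) / 8 := by
    have h1 : Real.exp 6 * Real.exp (-6) = 1 := by rw [← Real.exp_add]; simp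
    have h2 : Y * Real.exp (-6) / 8 = 1600 * Real.pi * Λ₁ * (Real.exp 6 * Real.exp (-6))
        + Real.exp (-6) / 2 := by rw [hYdef]; ring
    rw [h2, h1]
    linarith [Real.exp_pos (-6)]
  obtain ⟨C7, hC7, hsc⟩ := scaled (L := 5 * Y) (by linarith)
  obtain ⟨C6, hC6, hcirc⟩ := circ_lpot
  set ε₀ : ℝ := min 1 (1 / (Y ^ 2 * (C7 + 1))) with hε₀
  have hε0 : 0 < ε₀ := lt_min one_pos (by positivity)
  have hε1 : ε₀ ≤ 1 := min_le_left _ _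
  have hεC : C7 * ε₀ ≤ 1 / Y ^ 2 := by
    calc C7 * ε₀ ≤ (C7 + 1) * (1 / (Y ^ 2 * (C7 + 1))) := by
          gcongr
          · linarith
          · exact min_le_right _ _
      _ = 1 / Y ^ 2 := by field_simp
  refine ⟨ε₀, hε0, by linarith [Real.pi_gt_three], ?_⟩
  intro q hq hqε
  obtain ⟨C5, hC5, hbm⟩ := bm hq hε0 ((lt_div_iff₀ hε0).1 hqε)
  set R : ℝ := 3 * (5 * Y) ^ 2 with hR
  refine ⟨Real.exp (q * (8 * R + C6)) * C5 + 1, by positivity, ?_⟩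
  intro u hu harea hK
  obtain ⟨g, hg, hc, hs, hm, H, hH, huH, hcm⟩ := decomp hu hε0.le hK
  have hgi0 : 0 ≤ ∫ y, |g y| := integral_nonneg fun _ => abs_nonneg _
  have hvc : Continuous (lpot g) := (lpot_contDiff hg hc).continuous
  have hbd : ∀ z : ℂ, ‖z‖ ≤ 5/8 → (5/8 - ‖z‖) * ‖deriv H z‖ < 2 * R := by
    intro z hz
    by_contra hcon
    push Not at hcon
    obtain ⟨z0, a, ha, hblow⟩ := blow hH (L := 5 * Y) (by linarith) le_rfl hz hcon
    obtain ⟨vr, hvr⟩ := hsc g hg.continuous hc (hm.trans hε1) z0 a ha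
    obtain ⟨z', hz', hA⟩ := geo (u := u) hY ha (κ := (H z0).re + vr)
      (Ψ := fun w => |lpot g (z0 + a * w) - vr|) (by fun_prop) (fun w => abs_nonneg _)
      (fun w hw => (hblow w hw).1)
      (by
        intro w hw
        obtain ⟨h1, h2⟩ := hblow w hw
        rw [huH _ (ball_subset_ball (by norm_num) h1)]
        calc _ = |((H (z0 + a * w)).re - (H z0).re - w.re) + (lpot g (z0 + a * w) - vr)| := by
              congr 1; ring
          _ ≤ _ := (abs_add_le _ _).trans (by gcongr))
      (hvr.trans (ENNReal.ofReal_le_ofReal (le_trans (by gcongr) hεC)))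
    have ha' : 0 < ‖a‖ := norm_pos_iff.2 ha
    set k := ‖a‖ * Real.exp ((H z0).re + vr) with hk
    have hk0 : 0 < k := by positivity
    have hlt := harea (40 * k) (by positivity) z' hz'
    refine absurd (hA.trans_lt hlt) (not_lt.2 (ENNReal.ofReal_le_ofReal ?_))
    calc Λ₁ * (Real.pi * (40 * k) ^ 2) = k ^ 2 * (1600 * Real.pi * Λ₁) := by ring
      _ ≤ _ := by gcongr
  have hHd : ∀ z ∈ ball (0:ℂ) (1/2), ‖deriv H z‖ ≤ 16 * R := by
    intro z hz
    rw [mem_ball_zero_iff] at hz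
    have h1 := hbd z (by linarith)
    by_contra hcon
    push Not at hcon
    nlinarith [norm_nonneg (deriv H z)]
  have hosc : ∀ z ∈ ball (0:ℂ) (1/2), (H z).re - (H 0).re ≤ 8 * R := by
    intro z hz
    have h1 := (convex_ball (0:ℂ) (1/2)).norm_image_sub_le_of_norm_deriv_le (f := H) (C := 16 * R)
      (fun x hx => hH.differentiableAt (isOpen_ball.mem_nhds (ball_subset_ball (by norm_num) hx)))
      hHd (mem_ball_self (by norm_num)) hz
    have h2 := (le_abs_self _).trans ((Complex.abs_re_le_norm (H z - H 0)).trans h1)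
    rw [mem_ball_zero_iff] at hz
    rw [sub_zero, Complex.sub_re] at h2
    have hR0 : 0 ≤ R := by positivity
    nlinarith
  have hcm2 := abs_le.1 (hcirc g hg hc hs (hm.trans hε1))
  calc _ ≤ ∫⁻ x in ball (0:ℂ) (1/2), ENNReal.ofReal (Real.exp (q * (8 * R + C6))) *
        ENNReal.ofReal (Real.exp (q * |lpot g x|)) := by
        refine setLIntegral_mono' measurableSet_ball fun x hx => ?_
        rw [← ENNReal.ofReal_mul (by positivity), ← Real.exp_add, ← mul_add]
        refine ENNReal.ofReal_le_ofReal (Real.exp_le_exp.2 ?_)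
        gcongr
        rw [huH x (ball_subset_ball (by norm_num) hx), hcm]
        linarith [hosc x hx, hcm2.1, le_abs_self (lpot g x)]
    _ = ENNReal.ofReal (Real.exp (q * (8 * R + C6))) *
        ∫⁻ x in ball (0:ℂ) (1/2), ENNReal.ofReal (Real.exp (q * |lpot g x|)) :=
        lintegral_const_mul' _ _ ENNReal.ofReal_ne_top
    _ ≤ ENNReal.ofReal (Real.exp (q * (8 * R + C6))) * ENNReal.ofReal C5 := by
        gcongr
        exact hbm g hg.continuous hc hs hm
    _ = ENNReal.ofReal (Real.exp (q * (8 * R + C6)) * C5) := by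
        rw [ENNReal.ofReal_mul (by positivity)]
    _ < _ := by
        rw [ENNReal.ofReal_lt_ofReal_iff (by positivity)]
        linarith
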